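/- arXiv:2301.08681 — 3 statements merged into one kernel-verified Lean document; each statement's English description precedes it below -/
import Mathlib

section
/- Let Λ be a Nakayama algebra, and let G and G' be maximal backwards Hom-orthogonal sequences of bricks over Λ whose underlying sets of bricks coincide up to isomorphism (every entry of G is isomorphic to some entry of G' and vice versa). Then G can be transformed into G' by a finite sequence of swaps of two adjacent entries, such that every intermediate sequence is again a maximal backwards Hom-orthogonal sequence of bricks and the final sequence equals G' up to isomorphism of corresponding entries. -/
/-- A bundled finite-dimensional module over the finite-dimensional `K`-algebra `Λ`
(finite-dimensionality over the base field is equivalent to being finitely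
generated over `Λ`). -/
structure FDModule (Λ : Type) [Ring Λ] : Type 1 where
  carrier : Type
  [isAddCommGroup : AddCommGroup carrier]
  [isModule : Module Λ carrier]
  [isFinite : Module.Finite Λ carrier]

attribute [instance] FDModule.isAddCommGroup FDModule.isModule FDModule.isFinite

/-- `M` is a brick: `M` is non-zero and every non-zero endomorphism of `M` is an
isomorphism. -/
def IsBrick {Λ : Type} [Ring Λ] (M : FDModule Λ) : Prop :=
  Nontrivial M.carrier ∧ ∀ f : M.carrier →ₗ[Λ] M.carrier, f = 0 ∨ Function.Bijective f

/-- `Hom_Λ(M, N) = 0`. -/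
def NoHom {Λ : Type} [Ring Λ] (M N : FDModule Λ) : Prop :=
  ∀ f : M.carrier →ₗ[Λ] N.carrier, f = 0

/-- A list of modules is backwards Hom-orthogonal: homomorphisms from later
entries to earlier entries vanish. -/
def ListBHO {Λ : Type} [Ring Λ] (l : List (FDModule Λ)) : Prop :=
  l.Pairwise fun M N => ∀ f : N.carrier →ₗ[Λ] M.carrier, f = 0

/-- A maximal backwards Hom-orthogonal list of bricks: every entry is a brick, the
list is backwards Hom-orthogonal, and no brick can be inserted at any position
while keeping backwards Hom-orthogonality. -/
def IsMaxBHOList {Λ : Type} [Ring Λ] (l : List (FDModule Λ)) : Prop :=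
  (∀ M ∈ l, IsBrick M) ∧ ListBHO l ∧
    ∀ C : FDModule Λ, IsBrick C →
      ∀ l₁ l₂ : List (FDModule Λ), l = l₁ ++ l₂ → ¬ ListBHO (l₁ ++ C :: l₂)

/-- A module is uniserial if its submodules are totally ordered by inclusion. -/
def IsUniserialModule (Λ : Type) [Ring Λ] (M : Type) [AddCommGroup M] [Module Λ M] : Prop :=
  ∀ N₁ N₂ : Submodule Λ M, N₁ ≤ N₂ ∨ N₂ ≤ N₁

/-- A module is indecomposable if it is non-zero and is not the direct sum of two
non-zero submodules. -/
def IsIndecomposableModule (Λ : Type) [Ring Λ] (M : Type) [AddCommGroup M]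
    [Module Λ M] : Prop :=
  Nontrivial M ∧ ∀ N₁ N₂ : Submodule Λ M, IsCompl N₁ N₂ → N₁ = ⊥ ∨ N₂ = ⊥

/-- `Λ` is a Nakayama algebra: every finite-dimensional indecomposable `Λ`-module
is uniserial. -/
def IsNakayama (Λ : Type) [Ring Λ] : Prop :=
  ∀ M : FDModule Λ, IsIndecomposableModule Λ M.carrier → IsUniserialModule Λ M.carrier

section LinearMaps

variable {R : Type} [Ring R]

theorem exists_factor_of_surjective {A B C : Type} [AddCommGroup A] [Module R A]
    [AddCommGroup B] [Module R B] [AddCommGroup C] [Module R C]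
    (h : A →ₗ[R] C) (hs : Function.Surjective h) (f : A →ₗ[R] B)
    (hk : ∀ x, h x = 0 → f x = 0) : ∃ g : C →ₗ[R] B, ∀ x, g (h x) = f x := by
  refine ⟨(LinearMap.ker h).liftQ f hk ∘ₗ (h.quotKerEquivOfSurjective hs).symm, fun x => ?_⟩
  have : (h.quotKerEquivOfSurjective hs).symm (h x) = (LinearMap.ker h).mkQ x := by
    rw [LinearEquiv.symm_apply_eq]; rfl
  rw [LinearMap.comp_apply, LinearEquiv.coe_coe, this]
  exact (LinearMap.ker h).liftQ_apply f x

theorem exists_factor_of_injective {A B C : Type} [AddCommGroup A] [Module R A]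
    [AddCommGroup B] [Module R B] [AddCommGroup C] [Module R C]
    (i : C →ₗ[R] B) (hi : Function.Injective i) (f : A →ₗ[R] B)
    (hk : ∀ x, ∃ y, i y = f x) : ∃ g : A →ₗ[R] C, ∀ x, i (g x) = f x := by
  refine ⟨(LinearEquiv.ofInjective i hi).symm ∘ₗ f.codRestrict (LinearMap.range i) hk,
    fun x => ?_⟩
  have := (LinearEquiv.ofInjective i hi).apply_symm_apply
    (f.codRestrict (LinearMap.range i) hk x)
  exact congrArg Subtype.val this

theorem IsUniserialModule.submodule {M : Type} [AddCommGroup M] [Module R M]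
    (h : IsUniserialModule R M) (N : Submodule R M) : IsUniserialModule R N := by
  intro A B
  simpa [Submodule.map_le_map_iff_of_injective N.injective_subtype] using
    h (A.map N.subtype) (B.map N.subtype)

theorem IsUniserialModule.quotient {M : Type} [AddCommGroup M] [Module R M]
    (h : IsUniserialModule R M) (N : Submodule R M) : IsUniserialModule R (M ⧸ N) := by
  intro A B
  simpa [Submodule.comap_le_comap_iff_of_surjective N.mkQ_surjective] using
    h (A.comap N.mkQ) (B.comap N.mkQ)

/-- A uniserial extension of two Hom-orthogonal bricks is a brick. -/
theorem eq_zero_or_bijective_of_extension {X Y E : Type} [AddCommGroup X] [Module R X]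
    [AddCommGroup Y] [Module R Y] [AddCommGroup E] [Module R E]
    [Nontrivial X] [Nontrivial Y]
    (hX : ∀ f : X →ₗ[R] X, f = 0 ∨ Function.Bijective f)
    (hY : ∀ f : Y →ₗ[R] Y, f = 0 ∨ Function.Bijective f)
    (hXY : ∀ f : X →ₗ[R] Y, f = 0) (hYX : ∀ f : Y →ₗ[R] X, f = 0)
    (i : Y →ₗ[R] E) (hi : Function.Injective i) (π : E →ₗ[R] X) (hπ : Function.Surjective π)
    (hex : ∀ e, π e = 0 ↔ ∃ y, i y = e) (hE : IsUniserialModule R E) (f : E →ₗ[R] E) :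
    f = 0 ∨ Function.Bijective f := by
  have hπi : ∀ y, π (i y) = 0 := fun y => (hex _).2 ⟨y, rfl⟩
  have hfi : ∀ y, π (f (i y)) = 0 := fun y =>
    LinearMap.congr_fun (hYX (π ∘ₗ f ∘ₗ i)) y
  obtain ⟨g, hg⟩ := exists_factor_of_injective i hi (f ∘ₗ i) fun y => (hex _).1 (hfi y)
  obtain ⟨h, hh⟩ := exists_factor_of_surjective π hπ (π ∘ₗ f) fun e he => by
    obtain ⟨y, rfl⟩ := (hex e).1 he
    exact hfi y
  simp only [LinearMap.comp_apply] at hg hh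
  obtain ⟨x₀, hx₀⟩ := exists_ne (0 : X)
  obtain ⟨y₀, hy₀⟩ := exists_ne (0 : Y)
  obtain ⟨e₀, rfl⟩ := hπ x₀
  rcases hY g with rfl | hgb
  · left
    obtain ⟨k, hk⟩ := exists_factor_of_surjective π hπ f fun e he => by
      obtain ⟨y, rfl⟩ := (hex e).1 he
      rw [← hg]; simp
    have hhk : ∀ x, π (k x) = h x := fun x => by
      obtain ⟨e, rfl⟩ := hπ x
      rw [hk, hh]
    rcases hX h with rfl | hhb
    · obtain ⟨m, hm⟩ := exists_factor_of_injective i hi k fun x => (hex _).1 (hhk x)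
      ext e
      rw [← hk, ← hm, hXY m]
      simp
    · exfalso
      rcases hE (LinearMap.range i) (LinearMap.range k) with hle | hle
      · obtain ⟨x, hx⟩ := hle ⟨y₀, rfl⟩
        have hx0 : h x = h 0 := by rw [← hhk, hx, hπi, map_zero]
        rw [hhb.1 hx0, map_zero] at hx
        exact hy₀ (hi (by rw [← hx, map_zero]))
      · obtain ⟨y, hy⟩ := hle ⟨π e₀, rfl⟩
        have h0 : h (π e₀) = h 0 := by rw [← hhk, ← hy, hπi, map_zero]
        exact hx₀ (hhb.1 h0)
  · rcases hX h with rfl | hhb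
    · exfalso
      obtain ⟨m, hm⟩ := exists_factor_of_injective i hi f fun e => (hex _).1 (by rw [← hh]; simp)
      have hmi : ∀ y, m (i y) = g y := fun y => hi (by rw [hm, hg])
      rcases hE (LinearMap.range i) (LinearMap.ker m) with hle | hle
      · have : g y₀ = g 0 := by rw [← hmi, map_zero]; exact hle ⟨y₀, rfl⟩
        exact hy₀ (hgb.1 this)
      · obtain ⟨y, hy⟩ := hgb.2 (m e₀)
        obtain ⟨z, hz⟩ := hle (show e₀ - i y ∈ LinearMap.ker m by
          rw [LinearMap.mem_ker, map_sub, hmi, hy, sub_self])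
        apply hx₀
        rw [← sub_add_cancel e₀ (i y), ← hz, map_add, hπi, hπi, add_zero]
    · right
      refine ⟨(injective_iff_map_eq_zero f).2 fun e he => ?_, fun e => ?_⟩
      · have h0 : h (π e) = h 0 := by rw [hh, he, map_zero, map_zero]
        obtain ⟨y, rfl⟩ := (hex e).1 (hhb.1 h0)
        have h1 : g y = g 0 := hi (by rw [hg, he, map_zero, map_zero])
        rw [hgb.1 h1, map_zero]
      · obtain ⟨x, hx⟩ := hhb.2 (π e)
        obtain ⟨e', rfl⟩ := hπ x
        obtain ⟨y, hy⟩ := (hex (e - f e')).1 (by rw [map_sub, ← hh, hx, sub_self])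
        obtain ⟨z, rfl⟩ := hgb.2 y
        exact ⟨e' + i z, by rw [map_add, ← hg, hy]; abel⟩

/-- Pulling back along a submodule of `C ⧸ P` and pushing out along a quotient of `P`
realises an extension as a subquotient of `C`. -/
theorem exists_extension_subquotient {X Y C : Type} [AddCommGroup X] [Module R X]
    [AddCommGroup Y] [Module R Y] [AddCommGroup C] [Module R C] (P : Submodule R C)
    (u : X →ₗ[R] C ⧸ P) (hu : Function.Injective u)
    (v : P →ₗ[R] Y) (hv : Function.Surjective v) :
    ∃ (D : Submodule R C) (N : Submodule R D) (i : Y →ₗ[R] D ⧸ N) (π : D ⧸ N →ₗ[R] X),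
      Function.Injective i ∧ Function.Surjective π ∧ ∀ e, π e = 0 ↔ ∃ y, i y = e := by
  let D : Submodule R C := (LinearMap.range u).comap P.mkQ
  have hPD : P ≤ D := fun c hc => ⟨0, by
    rw [map_zero]; exact ((Submodule.Quotient.mk_eq_zero P).2 hc).symm⟩
  let j : P →ₗ[R] D := Submodule.inclusion hPD
  have hj : Function.Injective j := Submodule.inclusion_injective hPD
  obtain ⟨ρ, hρ⟩ := exists_factor_of_injective u hu (P.mkQ ∘ₗ D.subtype) fun d => d.2
  have hρs : Function.Surjective ρ := fun x => by
    obtain ⟨c, hc⟩ := P.mkQ_surjective (u x)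
    exact ⟨⟨c, x, hc.symm⟩, hu (by rw [hρ]; exact hc)⟩
  have hρj : ∀ d, ρ d = 0 ↔ ∃ p, j p = d := fun d => by
    rw [← map_eq_zero_iff u hu, hρ]
    change P.mkQ (d : C) = 0 ↔ _
    rw [Submodule.mkQ_apply, Submodule.Quotient.mk_eq_zero]
    exact ⟨fun h => ⟨⟨d, h⟩, rfl⟩, by rintro ⟨p, rfl⟩; exact p.2⟩
  let N : Submodule R D := (LinearMap.ker v).map j
  obtain ⟨i, hi⟩ := exists_factor_of_surjective v hv (N.mkQ ∘ₗ j) fun p hp =>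
    (Submodule.Quotient.mk_eq_zero N).2 ⟨p, hp, rfl⟩
  obtain ⟨π, hπ⟩ := exists_factor_of_surjective N.mkQ N.mkQ_surjective ρ fun d hd => by
    obtain ⟨p, -, rfl⟩ := (Submodule.Quotient.mk_eq_zero N).1 hd
    exact (hρj _).2 ⟨p, rfl⟩
  refine ⟨D, N, i, π, (injective_iff_map_eq_zero i).2 fun y hy => ?_, fun x => ?_, fun e => ?_⟩
  · obtain ⟨p, rfl⟩ := hv y
    rw [hi] at hy
    obtain ⟨p', hp', hpp⟩ := (Submodule.Quotient.mk_eq_zero N).1 hy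
    rw [← hj hpp]
    exact hp'
  · obtain ⟨d, rfl⟩ := hρs x
    exact ⟨N.mkQ d, hπ d⟩
  · obtain ⟨d, rfl⟩ := N.mkQ_surjective e
    rw [hπ, hρj]
    constructor
    · rintro ⟨p, rfl⟩
      exact ⟨v p, hi p⟩
    · rintro ⟨y, hy⟩
      obtain ⟨p, rfl⟩ := hv y
      rw [hi] at hy
      obtain ⟨p', -, hp'⟩ := (Submodule.Quotient.eq N).1 hy
      exact ⟨p - p', by rw [map_sub, hp']; exact sub_sub_cancel _ _⟩

end LinearMaps

section Bricks

variable {Λ : Type} [Ring Λ]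

theorem IsBrick.isUniserialModule (hNak : IsNakayama Λ) {M : FDModule Λ} (hM : IsBrick M) :
    IsUniserialModule Λ M.carrier := by
  refine hNak M ⟨hM.1, fun N₁ N₂ h => ?_⟩
  rcases hM.2 (N₁.projection N₂ h) with h0 | hb
  · left
    rw [eq_bot_iff]
    intro x hx
    rw [Submodule.mem_bot, ← Submodule.projection_apply_of_mem_left h hx, h0,
      LinearMap.zero_apply]
  · right
    rw [eq_bot_iff]
    intro x hx
    rw [Submodule.mem_bot]
    apply hb.1
    rw [map_zero, Submodule.projection_apply_eq_zero_iff h]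
    exact hx

theorem IsBrick.bijective_comp {M : FDModule Λ} (hM : IsBrick M) {A : Type} [AddCommGroup A]
    [Module Λ A] {f : M.carrier →ₗ[Λ] A} {g : A →ₗ[Λ] M.carrier} (h : g ∘ₗ f ≠ 0) :
    Function.Bijective (g ∘ₗ f) :=
  (hM.2 _).resolve_left h

theorem IsBrick.not_noHom_self {M : FDModule Λ} (hM : IsBrick M) : ¬ NoHom M M := by
  intro h
  obtain ⟨x, hx⟩ := @exists_ne _ hM.1 (0 : M.carrier)
  exact hx (LinearMap.congr_fun (h LinearMap.id) x)

theorem NoHom.of_surjective {M N B : FDModule Λ} (h : NoHom M B)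
    (g : M.carrier →ₗ[Λ] N.carrier) (hg : Function.Surjective g) : NoHom N B := by
  intro f
  ext x
  obtain ⟨y, rfl⟩ := hg x
  exact LinearMap.congr_fun (h (f ∘ₗ g)) y

theorem NoHom.of_injective {M N B : FDModule Λ} (h : NoHom B M)
    (g : N.carrier →ₗ[Λ] M.carrier) (hg : Function.Injective g) : NoHom B N := by
  intro f
  ext x
  apply hg
  rw [LinearMap.zero_apply, map_zero]
  exact LinearMap.congr_fun (h (g ∘ₗ f)) x

theorem NoHom.congr {M M' N N' : FDModule Λ} (h : NoHom M N)
    (e : M.carrier ≃ₗ[Λ] M'.carrier) (e' : N.carrier ≃ₗ[Λ] N'.carrier) : NoHom M' N' :=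
  (h.of_surjective e.toLinearMap e.surjective).of_injective e'.symm.toLinearMap
    e'.symm.injective

theorem IsBrick.congr {M N : FDModule Λ} (h : IsBrick M) (e : M.carrier ≃ₗ[Λ] N.carrier) :
    IsBrick N := by
  refine ⟨@Function.Injective.nontrivial _ _ h.1 _ e.injective, fun f => ?_⟩
  rcases h.2 (e.symm.toLinearMap ∘ₗ f ∘ₗ e.toLinearMap) with h0 | hb
  · left
    ext x
    have := LinearMap.congr_fun h0 (e.symm x)
    simpa using this
  · right
    have : (f : N.carrier → N.carrier) =
        e ∘ (e.symm.toLinearMap ∘ₗ f ∘ₗ e.toLinearMap) ∘ e.symm := by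
      ext x; simp
    rw [this]
    exact e.bijective.comp (hb.comp e.symm.bijective)

/-- Homomorphisms from the middle term of an extension vanish as soon as they do on both ends. -/
theorem NoHom.of_extension {X Y E B : FDModule Λ} (i : Y.carrier →ₗ[Λ] E.carrier)
    (π : E.carrier →ₗ[Λ] X.carrier) (hπ : Function.Surjective π)
    (hex : ∀ e, π e = 0 ↔ ∃ y, i y = e) (hX : NoHom X B) (hY : NoHom Y B) : NoHom E B := by
  intro f
  obtain ⟨g, hg⟩ := exists_factor_of_surjective π hπ f fun e he => by
    obtain ⟨y, rfl⟩ := (hex e).1 he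
    exact LinearMap.congr_fun (hY (f ∘ₗ i)) y
  ext e
  rw [← hg, hX g]
  rfl

/-- Homomorphisms to the middle term of an extension vanish as soon as they do to both ends. -/
theorem NoHom.to_extension {X Y E B : FDModule Λ} (i : Y.carrier →ₗ[Λ] E.carrier)
    (hi : Function.Injective i) (π : E.carrier →ₗ[Λ] X.carrier)
    (hex : ∀ e, π e = 0 ↔ ∃ y, i y = e) (hX : NoHom B X) (hY : NoHom B Y) : NoHom B E := by
  intro f
  obtain ⟨g, hg⟩ := exists_factor_of_injective i hi f fun b =>
    (hex _).1 (LinearMap.congr_fun (hX (π ∘ₗ f)) b)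
  ext b
  rw [← hg, hY g]
  simp

end Bricks

section Orthogonality

variable {Λ : Type} [Ring Λ]

/-- `Hom_Λ(M, B) = 0` for every entry `B` of `L`. -/
def NoHomTo (M : FDModule Λ) (L : List (FDModule Λ)) : Prop := ∀ B ∈ L, NoHom M B

/-- `Hom_Λ(B, M) = 0` for every entry `B` of `L`. -/
def NoHomFrom (L : List (FDModule Λ)) (M : FDModule Λ) : Prop := ∀ B ∈ L, NoHom B M

theorem listBHO_cons {M : FDModule Λ} {l : List (FDModule Λ)} :
    ListBHO (M :: l) ↔ NoHomFrom l M ∧ ListBHO l :=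
  List.pairwise_cons

theorem listBHO_append {p q : List (FDModule Λ)} :
    ListBHO (p ++ q) ↔ ListBHO p ∧ ListBHO q ∧ ∀ M ∈ p, NoHomFrom q M :=
  List.pairwise_append

theorem listBHO_insert {C : FDModule Λ} {p q : List (FDModule Λ)} :
    ListBHO (p ++ C :: q) ↔ ListBHO (p ++ q) ∧ NoHomTo C p ∧ NoHomFrom q C := by
  simp only [listBHO_append, listBHO_cons, NoHomFrom, NoHomTo, List.mem_cons, forall_eq_or_imp]
  grind

theorem listBHO_swap {X Y : FDModule Λ} {p q : List (FDModule Λ)} (hXY : NoHom X Y)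
    (h : ListBHO (p ++ X :: Y :: q)) : ListBHO (p ++ Y :: X :: q) := by
  simp only [listBHO_append, listBHO_cons, NoHomFrom, List.mem_cons, forall_eq_or_imp] at h ⊢
  grind

theorem ListBHO.congr {l l' : List (FDModule Λ)} (h : ListBHO l)
    (hl : List.Forall₂ (fun M N => Nonempty (M.carrier ≃ₗ[Λ] N.carrier)) l l') :
    ListBHO l' := by
  induction hl with
  | nil => exact List.Pairwise.nil
  | @cons M N l l' e hl ih =>
    rw [listBHO_cons] at h ⊢
    refine ⟨fun B hB => ?_, ih h.2⟩
    obtain ⟨A, hA, ⟨e'⟩⟩ : ∃ A ∈ l, Nonempty (A.carrier ≃ₗ[Λ] B.carrier) := by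
      clear ih h
      induction hl with
      | nil => simp at hB
      | cons e' _ ih =>
        rcases List.mem_cons.1 hB with rfl | hB
        · exact ⟨_, List.mem_cons_self, e'⟩
        · obtain ⟨A, hA, e''⟩ := ih hB
          exact ⟨A, List.mem_cons_of_mem _ hA, e''⟩
    obtain ⟨e⟩ := e
    exact (h.1 A hA).congr e' e

theorem IsMaxBHOList.nodup {l : List (FDModule Λ)} (h : IsMaxBHOList l) : l.Nodup := by
  refine (List.Pairwise.imp_of_mem ?_ h.2.1)
  rintro M _ hM - hMN rfl
  exact (h.1 M hM).not_noHom_self hMN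

theorem ListBHO.eq_of_equiv {l : List (FDModule Λ)} (hb : ∀ M ∈ l, IsBrick M) (h : ListBHO l)
    {M N : FDModule Λ} (hM : M ∈ l) (hN : N ∈ l) (e : M.carrier ≃ₗ[Λ] N.carrier) : M = N := by
  induction l with
  | nil => simp at hM
  | cons B l ih =>
    rw [listBHO_cons] at h
    have key : ∀ A ∈ l, (A.carrier ≃ₗ[Λ] B.carrier) → False := fun A hA e' =>
      (hb B List.mem_cons_self).not_noHom_self ((h.1 A hA).congr e' (LinearEquiv.refl _ _))
    rcases List.mem_cons.1 hM with rfl | hM' <;> rcases List.mem_cons.1 hN with rfl | hN'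
    · rfl
    · exact (key N hN' e.symm).elim
    · exact (key M hM' e).elim
    · exact ih (fun A hA => hb A (List.mem_cons_of_mem _ hA)) h.2 hM' hN'

theorem IsMaxBHOList.congr {l l' : List (FDModule Λ)} (h : IsMaxBHOList l)
    (hl : List.Forall₂ (fun M N => Nonempty (M.carrier ≃ₗ[Λ] N.carrier)) l l') :
    IsMaxBHOList l' := by
  have hsymm : ∀ {a b : List (FDModule Λ)},
      List.Forall₂ (fun M N => Nonempty (M.carrier ≃ₗ[Λ] N.carrier)) a b →
      List.Forall₂ (fun M N => Nonempty (M.carrier ≃ₗ[Λ] N.carrier)) b a := fun hab =>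
    (hab.imp fun _ _ ⟨e⟩ => ⟨e.symm⟩).flip
  refine ⟨?_, h.2.1.congr hl, ?_⟩
  · have hb := h.1
    clear h
    induction hl with
    | nil => simp
    | cons e _ ih =>
      rw [List.forall_mem_cons] at hb ⊢
      exact ⟨hb.1.congr e.some, ih hb.2⟩
  · rintro C hC l₁ l₂ rfl hins
    have ht := List.forall₂_take l₁.length hl
    have hd := List.forall₂_drop l₁.length hl
    rw [List.take_left] at ht
    rw [List.drop_left] at hd
    refine h.2.2 C hC _ _ (List.take_append_drop l₁.length l).symm (hins.congr ?_)
    exact List.rel_append (hsymm ht) (List.Forall₂.cons ⟨LinearEquiv.refl _ _⟩ (hsymm hd))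

end Orthogonality

section TorsionPairs

variable {Λ : Type} [Ring Λ]

theorem IsMaxBHOList.subsingleton [IsArtinianRing Λ] {p q : List (FDModule Λ)}
    (h : IsMaxBHOList (p ++ q)) (M : FDModule Λ) (hp : NoHomTo M p) (hq : NoHomFrom q M) :
    Subsingleton M.carrier := by
  by_contra hM
  rw [not_subsingleton_iff_nontrivial] at hM
  let S : Set (Submodule Λ M.carrier) := {N | N ≠ ⊥ ∧ NoHomTo ⟨N⟩ p}
  have htop : (⊤ : Submodule Λ M.carrier) ∈ S := ⟨top_ne_bot, fun B hB =>
    (hp B hB).of_surjective (N := ⟨(⊤ : Submodule Λ M.carrier)⟩)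
      (Submodule.topEquiv.symm.toLinearMap) Submodule.topEquiv.symm.surjective⟩
  obtain ⟨N, ⟨hN, hNp⟩, hmin⟩ := wellFounded_lt.has_min S ⟨⊤, htop⟩
  have hbrick : IsBrick (⟨N⟩ : FDModule Λ) := by
    refine ⟨(Submodule.nontrivial_iff_ne_bot).2 hN, fun f => ?_⟩
    rw [or_iff_not_imp_left]
    intro hf
    have hle : (LinearMap.range f).map N.subtype ≤ N := Submodule.map_subtype_le _ _
    have hmem : (LinearMap.range f).map N.subtype ∈ S := by
      refine ⟨?_, fun B hB => ?_⟩
      · rwa [← Submodule.map_bot N.subtype,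
          (Submodule.map_injective_of_injective N.injective_subtype).ne_iff, Ne,
          LinearMap.range_eq_bot]
      · refine (hNp B hB).of_surjective
          (((LinearMap.range f).equivMapOfInjective N.subtype
            N.injective_subtype).toLinearMap ∘ₗ f.rangeRestrict) ?_
        exact (Submodule.equivMapOfInjective _ N.injective_subtype _).surjective.comp
          f.surjective_rangeRestrict
    have heq := eq_of_le_of_not_lt hle (hmin _ hmem)
    have hs : Function.Surjective f := by
      rw [← LinearMap.range_eq_top]
      apply Submodule.map_injective_of_injective N.injective_subtype
      rw [heq, Submodule.map_top, Submodule.range_subtype]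
    exact IsNoetherian.bijective_of_surjective_endomorphism (M := N) f hs
  refine h.2.2 _ hbrick p q rfl (listBHO_insert.2 ⟨h.2.1, hNp, fun B hB => ?_⟩)
  exact (hq B hB).of_injective (N := ⟨N⟩) N.subtype N.injective_subtype

/-- The canonical submodule of the torsion pair attached to a cut of an orthogonal list. -/
theorem ListBHO.exists_torsion_submodule [IsNoetherianRing Λ] {p q : List (FDModule Λ)}
    (h : ListBHO (p ++ q)) (M : FDModule Λ) :
    ∃ N : Submodule Λ M.carrier, NoHomTo ⟨N⟩ p ∧ NoHomFrom q ⟨M.carrier ⧸ N⟩ := by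
  have hbot : NoHomTo (⟨(⊥ : Submodule Λ M.carrier)⟩ : FDModule Λ) p := fun B _ f => by
    ext x
    obtain rfl : x = 0 := Subsingleton.elim (α := (⊥ : Submodule Λ M.carrier)) _ _
    simp
  obtain ⟨N, hN, hmax⟩ := wellFounded_gt.has_min
    {N : Submodule Λ M.carrier | NoHomTo ⟨N⟩ p} ⟨⊥, hbot⟩
  refine ⟨N, hN, fun B hB g => ?_⟩
  let D : Submodule Λ M.carrier := (LinearMap.range g).comap N.mkQ
  have hND : N ≤ D := fun c hc => ⟨0, by
    rw [map_zero]; exact ((Submodule.Quotient.mk_eq_zero N).2 hc).symm⟩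
  let π : D →ₗ[Λ] LinearMap.range g := (N.mkQ ∘ₗ D.subtype).codRestrict _ fun d => d.2
  have hD : NoHomTo (⟨D⟩ : FDModule Λ) p := fun A hA => by
    refine NoHom.of_extension (X := ⟨LinearMap.range g⟩) (Y := ⟨N⟩) (E := ⟨D⟩)
      (Submodule.inclusion hND) π ?_ ?_ ?_ (hN A hA)
    · rintro ⟨x, hx⟩
      obtain ⟨c, rfl⟩ := N.mkQ_surjective x
      exact ⟨⟨c, hx⟩, rfl⟩
    · intro d
      rw [← Subtype.coe_inj]
      change N.mkQ (d : M.carrier) = 0 ↔ _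
      rw [Submodule.mkQ_apply, Submodule.Quotient.mk_eq_zero]
      exact ⟨fun hd => ⟨⟨d, hd⟩, rfl⟩, by rintro ⟨y, rfl⟩; exact y.2⟩
    · exact NoHom.of_surjective ((listBHO_append.1 h).2.2 A hA B hB)
        g.rangeRestrict g.surjective_rangeRestrict
  have hDN : D = N := (eq_of_le_of_not_lt hND (hmax D hD)).symm
  ext b
  obtain ⟨c, hc⟩ := N.mkQ_surjective (g b)
  have hcD : c ∈ D := ⟨b, hc.symm⟩
  rw [hDN] at hcD
  rw [← hc, LinearMap.zero_apply]
  exact (Submodule.Quotient.mk_eq_zero N).2 hcD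

variable [IsArtinianRing Λ] {p q : List (FDModule Λ)} {X : FDModule Λ}

theorem IsMaxBHOList.not_noHom_to (h : IsMaxBHOList (p ++ X :: q)) {M : FDModule Λ}
    (hM : Nontrivial M.carrier) (hp : NoHomTo M p) (hq : NoHomFrom q M) : ¬ NoHom M X := by
  intro hX
  rw [List.append_cons] at h
  refine not_subsingleton_iff_nontrivial.2 hM (h.subsingleton M ?_ hq)
  simpa [NoHomTo, or_imp, forall_and] using And.intro hp hX

theorem IsMaxBHOList.not_noHom_from (h : IsMaxBHOList (p ++ X :: q)) {M : FDModule Λ}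
    (hM : Nontrivial M.carrier) (hp : NoHomTo M p) (hq : NoHomFrom q M) : ¬ NoHom X M := by
  intro hX
  refine not_subsingleton_iff_nontrivial.2 hM (h.subsingleton M hp ?_)
  simpa [NoHomFrom, or_imp, forall_and] using And.intro hX hq

theorem IsMaxBHOList.injective_of_ne_zero (h : IsMaxBHOList (p ++ X :: q)) {M : FDModule Λ}
    (hq : NoHomFrom q M) (f : X.carrier →ₗ[Λ] M.carrier)
    (hf : f ≠ 0) : Function.Injective f := by
  obtain ⟨-, hXp, hXq⟩ := listBHO_insert.1 h.2.1
  have hX : IsBrick X := h.1 X (by simp)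
  have hnt : Nontrivial (LinearMap.range f) := by
    rwa [Submodule.nontrivial_iff_ne_bot, Ne, LinearMap.range_eq_bot]
  have hno := h.not_noHom_to (M := ⟨LinearMap.range f⟩) hnt
    (fun B hB => (hXp B hB).of_surjective f.rangeRestrict f.surjective_rangeRestrict)
    (fun B hB => (hq B hB).of_injective (N := ⟨LinearMap.range f⟩) (Submodule.subtype _)
      (Submodule.injective_subtype _))
  unfold NoHom at hno
  push Not at hno
  obtain ⟨g, hg⟩ := hno
  have hcomp : g ∘ₗ f.rangeRestrict ≠ 0 := fun h0 => hg <| by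
    ext x
    obtain ⟨y, rfl⟩ := f.surjective_rangeRestrict x
    exact LinearMap.congr_fun h0 y
  intro a b hab
  exact (hX.bijective_comp hcomp).1 (congrArg g (Subtype.ext hab :
    f.rangeRestrict a = f.rangeRestrict b))

theorem IsMaxBHOList.surjective_of_ne_zero (h : IsMaxBHOList (p ++ X :: q)) {M : FDModule Λ}
    (hp : NoHomTo M p) (f : M.carrier →ₗ[Λ] X.carrier)
    (hf : f ≠ 0) : Function.Surjective f := by
  obtain ⟨-, hXp, hXq⟩ := listBHO_insert.1 h.2.1
  have hX : IsBrick X := h.1 X (by simp)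
  have hnt : Nontrivial (LinearMap.range f) := by
    rwa [Submodule.nontrivial_iff_ne_bot, Ne, LinearMap.range_eq_bot]
  have hno := h.not_noHom_from (M := ⟨LinearMap.range f⟩) hnt
    (fun B hB => (hp B hB).of_surjective f.rangeRestrict f.surjective_rangeRestrict)
    (fun B hB => (hXq B hB).of_injective (N := ⟨LinearMap.range f⟩) (Submodule.subtype _)
      (Submodule.injective_subtype _))
  unfold NoHom at hno
  push Not at hno
  obtain ⟨g, hg⟩ := hno
  have hcomp : (LinearMap.range f).subtype ∘ₗ g ≠ 0 := fun h0 => hg <| by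
    ext x
    exact LinearMap.congr_fun h0 x
  intro x
  obtain ⟨y, hy⟩ := (hX.bijective_comp hcomp).2 x
  obtain ⟨m, hm⟩ := (g y).2
  exact ⟨m, hm.trans hy⟩

theorem IsMaxBHOList.exists_injective (h : IsMaxBHOList (p ++ X :: q)) {M : FDModule Λ}
    (hM : Nontrivial M.carrier) (hp : NoHomTo M p) (hq : NoHomFrom q M) :
    ∃ f : X.carrier →ₗ[Λ] M.carrier, Function.Injective f := by
  have := h.not_noHom_from hM hp hq
  unfold NoHom at this
  push Not at this
  obtain ⟨f, hf⟩ := this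
  exact ⟨f, h.injective_of_ne_zero hq f hf⟩

theorem IsMaxBHOList.exists_surjective (h : IsMaxBHOList (p ++ X :: q)) {M : FDModule Λ}
    (hM : Nontrivial M.carrier) (hp : NoHomTo M p) (hq : NoHomFrom q M) :
    ∃ f : M.carrier →ₗ[Λ] X.carrier, Function.Surjective f := by
  have := h.not_noHom_to hM hp hq
  unfold NoHom at this
  push Not at this
  obtain ⟨f, hf⟩ := this
  exact ⟨f, h.surjective_of_ne_zero hp f hf⟩

theorem IsMaxBHOList.nonempty_equiv (h : IsMaxBHOList (p ++ X :: q)) {M : FDModule Λ}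
    (hM : IsBrick M) (hp : NoHomTo M p) (hq : NoHomFrom q M) :
    Nonempty (X.carrier ≃ₗ[Λ] M.carrier) := by
  obtain ⟨f, hf⟩ := h.exists_injective hM.1 hp hq
  obtain ⟨g, hg⟩ := h.exists_surjective hM.1 hp hq
  have hX : IsBrick X := h.1 X (by simp)
  have hcomp : f ∘ₗ g ≠ 0 := fun h0 => by
    obtain ⟨x, hx⟩ := @exists_ne _ hX.1 (0 : X.carrier)
    obtain ⟨m, rfl⟩ := hg x
    exact hx (hf ((LinearMap.congr_fun h0 m).trans (map_zero f).symm))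
  refine ⟨LinearEquiv.ofBijective f ⟨hf, fun m => ?_⟩⟩
  obtain ⟨m', hm'⟩ := (hM.bijective_comp hcomp).2 m
  exact ⟨g m', hm'⟩

end TorsionPairs

section Swaps

variable {Λ : Type} [Ring Λ]

/-- One step of the swap relation between maximal lists. -/
def MaxBHOSwap (l l' : List (FDModule Λ)) : Prop :=
  IsMaxBHOList l' ∧ ∃ (l₁ l₂ : List (FDModule Λ)) (X Y : FDModule Λ),
    l = l₁ ++ X :: Y :: l₂ ∧ l' = l₁ ++ Y :: X :: l₂

theorem Relation.ReflTransGen.isMaxBHOList {l l' : List (FDModule Λ)}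
    (hl : Relation.ReflTransGen MaxBHOSwap l l') (h : IsMaxBHOList l) : IsMaxBHOList l' := by
  cases hl with
  | refl => exact h
  | tail _ hs => exact hs.1

theorem exists_fin_seq_of_reflTransGen {α : Type*} {r : α → α → Prop} {a b : α}
    (h : Relation.ReflTransGen r a b) :
    ∃ (n : ℕ) (seq : Fin (n + 1) → α), seq 0 = a ∧ seq (Fin.last n) = b ∧
      ∀ m : Fin n, r (seq m.castSucc) (seq m.succ) := by
  induction h with
  | refl => exact ⟨0, fun _ => a, rfl, rfl, fun m => m.elim0⟩
  | @tail b c _ hbc ih =>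
    obtain ⟨n, seq, h0, hl, hs⟩ := ih
    refine ⟨n + 1, Fin.snoc (α := fun _ => α) seq c, ?_, Fin.snoc_last _ _, fun m => ?_⟩
    · rw [← Fin.castSucc_zero, Fin.snoc_castSucc, h0]
    · rw [Fin.snoc_castSucc]
      induction m using Fin.lastCases with
      | last => rw [Fin.succ_last, Fin.snoc_last, hl]; exact hbc
      | cast m => rw [Fin.succ_castSucc, Fin.snoc_castSucc]; exact hs m

variable [IsArtinianRing Λ]

/-- If inserting a brick obstructs the maximality of a list with two adjacent Hom-orthogonal
entries swapped, then a brick is an extension of these two entries. -/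
theorem IsMaxBHOList.exists_brick_extension (hNak : IsNakayama Λ) {p q : List (FDModule Λ)}
    {X Y C : FDModule Λ} (h : IsMaxBHOList (p ++ X :: Y :: q)) (hXY : NoHom X Y)
    (hYX : NoHom Y X) (hC : IsBrick C) (hCp : NoHomTo C p) (hCY : NoHom C Y)
    (hXC : NoHom X C) (hCq : NoHomFrom q C) :
    ∃ (E : FDModule Λ) (i : Y.carrier →ₗ[Λ] E.carrier) (π : E.carrier →ₗ[Λ] X.carrier),
      IsBrick E ∧ Function.Injective i ∧ Function.Surjective π ∧
        ∀ e, π e = 0 ↔ ∃ y, i y = e := by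
  have hX : IsBrick X := h.1 X (by simp)
  have hY : IsBrick Y := h.1 Y (by simp)
  have h' : IsMaxBHOList ((p ++ [X]) ++ Y :: q) := by simpa using h
  have hYq : NoHomFrom q Y := (listBHO_insert.1 h'.2.1).2.2
  have hXp : NoHomTo X p := (listBHO_insert.1 h.2.1).2.1
  obtain ⟨P, hP, hQ⟩ := h'.2.1.exists_torsion_submodule C
  have hPq : NoHomFrom q ⟨P⟩ := fun B hB =>
    (hCq B hB).of_injective (N := ⟨P⟩) P.subtype P.injective_subtype
  have hQp : NoHomTo ⟨C.carrier ⧸ P⟩ p := fun B hB =>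
    (hCp B hB).of_surjective (N := ⟨C.carrier ⧸ P⟩) P.mkQ P.mkQ_surjective
  have hPnt : Nontrivial P := by
    rw [Submodule.nontrivial_iff_ne_bot]
    rintro rfl
    refine h.not_noHom_from hC.1 hCp (fun B hB => ?_) hXC
    exact (hQ B hB).of_injective (Submodule.mkQ ⊥)
      (LinearMap.ker_eq_bot.1 (Submodule.ker_mkQ _))
  have hQnt : Nontrivial (C.carrier ⧸ P) := by
    rw [Submodule.Quotient.nontrivial_iff]
    rintro rfl
    refine h'.not_noHom_to hC.1 (fun B hB => ?_) hCq hCY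
    exact (hP B hB).of_surjective (Submodule.subtype ⊤) fun x => ⟨⟨x, trivial⟩, rfl⟩
  obtain ⟨u, hu⟩ := h.exists_injective (M := ⟨C.carrier ⧸ P⟩) hQnt hQp hQ
  obtain ⟨v, hv⟩ := h'.exists_surjective (M := ⟨P⟩) hPnt hP hPq
  obtain ⟨D, N, i, π, hi, hπ, hex⟩ := exists_extension_subquotient P u hu v hv
  have := hX.1
  have := hY.1
  refine ⟨⟨D ⧸ N⟩, i, π, ⟨hi.nontrivial, ?_⟩, hi, hπ, hex⟩
  exact eq_zero_or_bijective_of_extension hX.2 hY.2 hXY hYX i hi π hπ hex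
    (((hC.isUniserialModule hNak).submodule D).quotient N)

/-- If `Y` occurs before the cut and `X` after it, then a uniserial extension of `X` by `Y`
is torsion or torsion-free for the torsion pair attached to the cut. -/
theorem ListBHO.noHomTo_or_noHomFrom_of_extension {p q : List (FDModule Λ)}
    (h : ListBHO (p ++ q)) {X Y E : FDModule Λ} (hYp : Y ∈ p) (hXq : X ∈ q)
    (hE : IsUniserialModule Λ E.carrier)
    (i : Y.carrier →ₗ[Λ] E.carrier) (hi : Function.Injective i)
    (π : E.carrier →ₗ[Λ] X.carrier) (hπ : Function.Surjective π)
    (hex : ∀ e, π e = 0 ↔ ∃ y, i y = e) : NoHomTo E p ∨ NoHomFrom q E := by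
  obtain ⟨N, hNp, hNq⟩ := h.exists_torsion_submodule E
  rcases hE N (LinearMap.range i) with hle | hle
  · right
    obtain ⟨g, hg⟩ := exists_factor_of_injective i hi N.subtype fun n => hle n.2
    have hbot : N = ⊥ := by
      rw [eq_bot_iff]
      intro n hn
      have := hg ⟨n, hn⟩
      rw [hNp Y hYp g, LinearMap.zero_apply, map_zero] at this
      exact this.symm
    subst hbot
    exact fun B hB => (hNq B hB).of_injective (Submodule.mkQ ⊥)
      (LinearMap.ker_eq_bot.1 (Submodule.ker_mkQ _))
  · left
    obtain ⟨g, hg⟩ := exists_factor_of_surjective π hπ N.mkQ fun e he => by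
      rw [Submodule.mkQ_apply, Submodule.Quotient.mk_eq_zero]
      exact hle ((hex e).1 he)
    have htop : ∀ e, e ∈ N := fun e => by
      have := hg e
      rw [hNq X hXq g, LinearMap.zero_apply] at this
      exact (Submodule.Quotient.mk_eq_zero N).1 this.symm
    exact fun B hB => (hNp B hB).of_surjective N.subtype fun e => ⟨⟨e, htop e⟩, rfl⟩

/-- If `Y` precedes `X` in a maximal list, every brick extension of `X` by `Y` is an entry. -/
theorem IsMaxBHOList.exists_equiv_of_extension (hNak : IsNakayama Λ)
    {a b c : List (FDModule Λ)} {X Y E : FDModule Λ}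
    (h : IsMaxBHOList (a ++ Y :: b ++ X :: c)) (hE : IsBrick E)
    (i : Y.carrier →ₗ[Λ] E.carrier) (hi : Function.Injective i)
    (π : E.carrier →ₗ[Λ] X.carrier) (hπ : Function.Surjective π)
    (hex : ∀ e, π e = 0 ↔ ∃ y, i y = e) :
    ∃ B ∈ a ++ Y :: b ++ X :: c, Nonempty (B.carrier ≃ₗ[Λ] E.carrier) := by
  have hEu := hE.isUniserialModule hNak
  have hX := listBHO_insert.1 h.2.1
  have hY : ListBHO (a ++ Y :: (b ++ X :: c)) := by simpa using h.2.1
  replace hY := listBHO_insert.1 hY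
  have hEa : NoHomTo E a := fun B hB =>
    NoHom.of_extension i π hπ hex (hX.2.1 B (by simp [hB])) (hY.2.1 B hB)
  have hEc : NoHomFrom c E := fun B hB =>
    NoHom.to_extension i hi π hex (hX.2.2 B hB) (hY.2.2 B (by simp [hB]))
  have cut : ∀ (s r : List (FDModule Λ)), NoHomTo E r →
      Y ∈ r → IsMaxBHOList (r ++ s ++ X :: c) →
      ∃ B ∈ r ++ s ++ X :: c, Nonempty (B.carrier ≃ₗ[Λ] E.carrier) := by
    intro s
    induction s with
    | nil =>
      intro r hr _ hm
      rw [List.append_nil] at hm ⊢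
      exact ⟨X, by simp, hm.nonempty_equiv hE hr hEc⟩
    | cons B s ih =>
      intro r hr hYr hm
      rcases ListBHO.noHomTo_or_noHomFrom_of_extension (p := r ++ [B]) (q := s ++ X :: c)
        (by simpa using hm.2.1) (by simp [hYr]) (by simp) hEu i hi π hπ hex with hto | hfrom
      · simpa using ih (r ++ [B]) hto (by simp [hYr]) (by simpa using hm)
      · have hm' : IsMaxBHOList (r ++ B :: (s ++ X :: c)) := by simpa using hm
        exact ⟨B, by simp, hm'.nonempty_equiv hE hr hfrom⟩
  rcases ListBHO.noHomTo_or_noHomFrom_of_extension (p := a ++ [Y]) (q := b ++ X :: c)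
    (by simpa using h.2.1) (by simp) (by simp) hEu i hi π hπ hex with hto | hfrom
  · simpa using cut b (a ++ [Y]) hto (by simp) (by simpa using h)
  · have hm' : IsMaxBHOList (a ++ Y :: (b ++ X :: c)) := by simpa using h
    exact ⟨Y, by simp, hm'.nonempty_equiv hE hEa hfrom⟩

theorem IsMaxBHOList.swap (hNak : IsNakayama Λ) {p q a b c : List (FDModule Λ)}
    {X Y : FDModule Λ} (h : IsMaxBHOList (p ++ X :: Y :: q))
    (h' : IsMaxBHOList (a ++ Y :: b ++ X :: c))
    (hperm : (p ++ X :: Y :: q).Perm (a ++ Y :: b ++ X :: c)) :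
    IsMaxBHOList (p ++ Y :: X :: q) := by
  have hXY : NoHom X Y := (listBHO_insert.1 h'.2.1).2.1 Y (by simp)
  have hXl := listBHO_insert.1 h.2.1
  have hYX : NoHom Y X := hXl.2.2 Y (by simp)
  have hYl : ListBHO ((p ++ [X]) ++ Y :: q) := by simpa using h.2.1
  replace hYl := listBHO_insert.1 hYl
  refine ⟨fun M hM => h.1 M (by simp at hM ⊢; tauto), listBHO_swap hXY h.2.1, ?_⟩
  intro C hC l₁ l₂ hl hins
  have hcut : ∀ r s, p ++ X :: Y :: q = r ++ s → NoHomTo C r → ¬ NoHomFrom s C :=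
    fun r s hrs hr hs => h.2.2 C hC r s hrs (listBHO_insert.2 ⟨hrs ▸ h.2.1, hr, hs⟩)
  obtain ⟨-, h₁, h₂⟩ := listBHO_insert.1 hins
  rcases List.append_eq_append_iff.1 hl with ⟨t, rfl, ht⟩ | ⟨t, rfl, rfl⟩
  · match t, ht with
    | [], ht =>
      rw [List.nil_append] at ht
      subst ht
      refine hcut p (X :: Y :: q) rfl (by simpa using h₁) fun B hB => h₂ B ?_
      simp at hB ⊢; tauto
    | [Z], ht =>
      simp only [List.cons_append, List.nil_append, List.cons.injEq] at ht
      obtain ⟨rfl, rfl⟩ := ht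
      obtain ⟨E, i, π, hE, hi, hπ, hex⟩ := h.exists_brick_extension hNak hXY hYX hC
        (fun B hB => h₁ B (by simp [hB])) (h₁ _ (by simp)) (h₂ _ (by simp))
        (fun B hB => h₂ B (by simp [hB]))
      obtain ⟨B, hB, ⟨e⟩⟩ := h'.exists_equiv_of_extension hNak hE i hi π hπ hex
      have hYB : ¬ NoHom Y B := fun h0 => by
        obtain ⟨y, hy⟩ := @exists_ne _ (h.1 Y (by simp)).1 (0 : Y.carrier)
        have := h0.congr (LinearEquiv.refl Λ _) e i
        exact hy (hi (by rw [this]; simp))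
      have hBX : ¬ NoHom B X := fun h0 => by
        obtain ⟨x, hx⟩ := @exists_ne _ (h.1 X (by simp)).1 (0 : X.carrier)
        have := h0.congr e (LinearEquiv.refl Λ _) π
        obtain ⟨y, rfl⟩ := hπ x
        exact hx (by rw [this]; simp)
      have hBG := hperm.mem_iff.2 hB
      simp only [List.mem_append, List.mem_cons] at hBG
      rcases hBG with hBp | rfl | rfl | hBq
      · exact hYB (hYl.2.1 B (by simp [hBp]))
      · exact hYB hYX
      · exact hBX hYX
      · exact hBX (hXl.2.2 B (by simp [hBq]))
    | Z :: W :: t, ht =>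
      simp only [List.cons_append, List.cons.injEq] at ht
      obtain ⟨rfl, rfl, rfl⟩ := ht
      refine hcut (p ++ X :: Y :: t) l₂ (by simp) (fun B hB => h₁ B ?_) h₂
      simp at hB ⊢; tauto
  · refine hcut l₁ (t ++ X :: Y :: q) (by simp) h₁ fun B hB => h₂ B ?_
    simp at hB ⊢; tauto

theorem IsMaxBHOList.reflTransGen_move (hNak : IsNakayama Λ) {p t : List (FDModule Λ)}
    {Y : FDModule Λ} (h' : IsMaxBHOList (p ++ Y :: t)) (u : List (FDModule Λ)) :
    ∀ v, IsMaxBHOList (p ++ (u ++ Y :: v)) → (u ++ v).Perm t →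
      Relation.ReflTransGen MaxBHOSwap (p ++ (u ++ Y :: v)) (p ++ Y :: (u ++ v)) := by
  induction u using List.reverseRecOn with
  | nil => exact fun v _ _ => Relation.ReflTransGen.refl
  | append_singleton u X ih =>
    intro v h hperm
    obtain ⟨b, c, rfl⟩ := List.append_of_mem (hperm.subset (show X ∈ u ++ [X] ++ v by simp))
    have hswap : IsMaxBHOList ((p ++ u) ++ Y :: X :: v) := by
      refine IsMaxBHOList.swap hNak (a := p) (b := b) (c := c) (by simpa using h)
        (by simpa using h') ?_
      have : (u ++ X :: Y :: v).Perm (Y :: (u ++ X :: v)) := by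
        simpa using (List.perm_middle (a := Y) (l₁ := u ++ [X]) (l₂ := v))
      simpa using (this.trans ((show (u ++ X :: v).Perm (b ++ X :: c) by
        simpa using hperm).cons Y)).append_left p
    refine Relation.ReflTransGen.head (b := p ++ (u ++ Y :: X :: v))
      ⟨by simpa using hswap, p ++ u, v, X, Y, by simp, by simp⟩ ?_
    simpa using ih (X :: v) (by simpa using hswap) (by simpa using hperm)

theorem IsMaxBHOList.reflTransGen_of_perm (hNak : IsNakayama Λ) (t : List (FDModule Λ)) :
    ∀ p s, IsMaxBHOList (p ++ s) → IsMaxBHOList (p ++ t) → s.Perm t →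
      Relation.ReflTransGen MaxBHOSwap (p ++ s) (p ++ t) := by
  induction t with
  | nil =>
    intro p s _ _ hst
    rw [hst.eq_nil]
  | cons Y t ih =>
    intro p s hs ht hst
    obtain ⟨u, v, rfl⟩ := List.append_of_mem (hst.symm.subset List.mem_cons_self)
    have huv : (u ++ v).Perm t := List.Perm.cons_inv (List.perm_middle.symm.trans hst)
    have hmove := ht.reflTransGen_move hNak u v hs huv
    have := hmove.isMaxBHOList hs
    refine hmove.trans ?_
    simpa using ih (p ++ [Y]) (u ++ v) (by simpa using this) (by simpa using ht) huv

end Swaps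

/-- Two maximal lists with the same entries up to isomorphism are permutations of one another
up to isomorphism. -/
theorem IsMaxBHOList.exists_perm {Λ : Type} [Ring Λ] {G G' : List (FDModule Λ)}
    (hG : IsMaxBHOList G) (hG' : IsMaxBHOList G')
    (h1 : ∀ M ∈ G, ∃ N ∈ G', Nonempty (M.carrier ≃ₗ[Λ] N.carrier))
    (h2 : ∀ N ∈ G', ∃ M ∈ G, Nonempty (N.carrier ≃ₗ[Λ] M.carrier)) :
    ∃ H, IsMaxBHOList H ∧ G.Perm H ∧
      List.Forall₂ (fun M N => Nonempty (M.carrier ≃ₗ[Λ] N.carrier)) H G' := by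
  choose! φ hφ hφe using h2
  have hH : List.Forall₂ (fun M N => Nonempty (M.carrier ≃ₗ[Λ] N.carrier)) G' (G'.map φ) :=
    List.forall₂_map_right_iff.2 (List.forall₂_same.2 hφe)
  have hmax := hG'.congr hH
  refine ⟨G'.map φ, hmax, (List.perm_ext_iff_of_nodup hG.nodup hmax.nodup).2 fun M => ?_,
    (hH.imp fun _ _ ⟨e⟩ => ⟨e.symm⟩).flip⟩
  refine ⟨fun hM => ?_, fun hM => ?_⟩
  · obtain ⟨N, hN, ⟨e⟩⟩ := h1 M hM
    rw [hG.2.1.eq_of_equiv hG.1 hM (hφ N hN) (e.trans (hφe N hN).some)]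
    exact List.mem_map_of_mem hN
  · obtain ⟨N, hN, rfl⟩ := List.mem_map.1 hM
    exact hφ N hN

/-- over a Nakayama algebra, two maximal backwards Hom-orthogonal
sequences of bricks with the same underlying set of bricks up to isomorphism are
related by a finite sequence of adjacent swaps through maximal backwards
Hom-orthogonal sequences. -/
theorem statement_13 (K : Type) [Field K] (Λ : Type) [Ring Λ] [Algebra K Λ]
    [FiniteDimensional K Λ] (hNak : IsNakayama Λ)
    (G G' : List (FDModule Λ)) (hG : IsMaxBHOList G) (hG' : IsMaxBHOList G')
    (h1 : ∀ M ∈ G, ∃ N ∈ G', Nonempty (M.carrier ≃ₗ[Λ] N.carrier))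
    (h2 : ∀ N ∈ G', ∃ M ∈ G, Nonempty (N.carrier ≃ₗ[Λ] M.carrier)) :
    ∃ (n : ℕ) (seq : Fin (n + 1) → List (FDModule Λ)),
      seq 0 = G ∧ (∀ m, IsMaxBHOList (seq m)) ∧
      (∀ m : Fin n, ∃ (l₁ l₂ : List (FDModule Λ)) (X Y : FDModule Λ),
        seq m.castSucc = l₁ ++ X :: Y :: l₂ ∧ seq m.succ = l₁ ++ Y :: X :: l₂) ∧
      List.Forall₂ (fun M N => Nonempty (M.carrier ≃ₗ[Λ] N.carrier))
        (seq (Fin.last n)) G' := by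
  have : IsArtinianRing Λ := isArtinian_of_tower K inferInstance
  obtain ⟨H, hH, hperm, hiso⟩ := hG.exists_perm hG' h1 h2
  obtain ⟨n, seq, h0, hlast, hstep⟩ := exists_fin_seq_of_reflTransGen
    (IsMaxBHOList.reflTransGen_of_perm hNak H [] G hG hH hperm)
  refine ⟨n, seq, h0, fun m => ?_, fun m => (hstep m).2, hlast ▸ hiso⟩
  induction m using Fin.cases with
  | zero => exact h0 ▸ hG
  | succ m => exact (hstep m).1
end

section
/- Let T ⊃ V ⊃ U be a chain of minimal inclusions of torsion classes of Λ-modules in which T ⊃ V is labelled by a brick L and V ⊃ U is labelled by a brick M. Let T = W_0 ⊃ W_1 ⊃ … ⊃ W_r = U (with r ≥ 2 and W_1 ≠ V) be another chain of minimal inclusions of torsion classes in which each W_{k−1} ⊃ W_k is labelled by a brick B_k. Then B_1 ≅ M and B_r ≅ L. -/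
/-- `0 → L → M → N → 0` is a short exact sequence. -/
def IsShortExact {Λ : Type} [Ring Λ] {L M N : Type} [AddCommGroup L] [Module Λ L]
    [AddCommGroup M] [Module Λ M] [AddCommGroup N] [Module Λ N]
    (f : L →ₗ[Λ] M) (g : M →ₗ[Λ] N) : Prop :=
  Function.Injective f ∧ LinearMap.range f = LinearMap.ker g ∧ Function.Surjective g

/-- The short exact sequence with surjection `g` splits, i.e. `g` admits a
linear section. -/
def SESSplits {Λ : Type} [Ring Λ] {M N : Type} [AddCommGroup M] [Module Λ M]
    [AddCommGroup N] [Module Λ N] (g : M →ₗ[Λ] N) : Prop :=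
  ∃ s : N →ₗ[Λ] M, g.comp s = LinearMap.id

/-- The module `M` lies in `Filt(X)`: it has a finite chain of submodules
`⊥ = c 0 ⊆ c 1 ⊆ … ⊆ c t = ⊤` all of whose subquotients are isomorphic to `X`. -/
def InFilt {Λ : Type} [Ring Λ] (X : FDModule Λ) (M : Type) [AddCommGroup M]
    [Module Λ M] : Prop :=
  ∃ (t : ℕ) (c : Fin (t + 1) → Submodule Λ M),
    Monotone c ∧ c 0 = ⊥ ∧ c (Fin.last t) = ⊤ ∧
      ∀ k : Fin t,
        Nonempty ((↥(c k.succ) ⧸ Submodule.comap (c k.succ).subtype (c k.castSucc))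
          ≃ₗ[Λ] X.carrier)

/-- A torsion class: a class of (finite-dimensional) modules closed under
isomorphisms, containing `0`, and closed under quotient modules and extensions. -/
def IsTorsionClass {Λ : Type} [Ring Λ] (T : Set (FDModule Λ)) : Prop :=
  (∀ M N : FDModule Λ, M ∈ T → Nonempty (M.carrier ≃ₗ[Λ] N.carrier) → N ∈ T) ∧
  (∀ M : FDModule Λ, Subsingleton M.carrier → M ∈ T) ∧
  (∀ M N : FDModule Λ, M ∈ T →
      (∃ f : M.carrier →ₗ[Λ] N.carrier, Function.Surjective f) → N ∈ T) ∧
  (∀ L M N : FDModule Λ, L ∈ T → N ∈ T →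
      ∀ (f : L.carrier →ₗ[Λ] M.carrier) (g : M.carrier →ₗ[Λ] N.carrier),
        IsShortExact f g → M ∈ T)

/-- `U ⊂ T` is a minimal inclusion of torsion classes. -/
def IsMinimalInclusion {Λ : Type} [Ring Λ] (T U : Set (FDModule Λ)) : Prop :=
  IsTorsionClass T ∧ IsTorsionClass U ∧ U ⊂ T ∧
    ∀ V : Set (FDModule Λ), IsTorsionClass V → U ⊆ V → V ⊆ T → V = U ∨ V = T

/-- `U^⊥`: the class of modules admitting no non-zero homomorphism from any member
of `U`. -/
def PerpSet {Λ : Type} [Ring Λ] (U : Set (FDModule Λ)) : Set (FDModule Λ) :=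
  {M | ∀ U' ∈ U, ∀ f : U'.carrier →ₗ[Λ] M.carrier, f = 0}

/-- The class of modules filtered by `B`. -/
def FiltSet {Λ : Type} [Ring Λ] (B : FDModule Λ) : Set (FDModule Λ) :=
  {M | InFilt B M.carrier}

/-- The minimal inclusion `U ⊂ T` is labelled by the brick `B`:
`T ∩ U^⊥ = Filt(B)`. -/
def IsBrickLabel {Λ : Type} [Ring Λ] (T U : Set (FDModule Λ)) (B : FDModule Λ) : Prop :=
  IsBrick B ∧ T ∩ PerpSet U = FiltSet B

section

variable {Λ : Type} [Ring Λ]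

/-- The top factor of a nontrivial module filtered by `X` is a quotient isomorphic to `X`. -/
theorem InFilt.exists_surjective {X : FDModule Λ} {M : Type} [AddCommGroup M] [Module Λ M]
    [Nontrivial M] (h : InFilt X M) :
    ∃ f : M →ₗ[Λ] X.carrier, Function.Surjective f := by
  obtain ⟨t, c, -, h0, h1, hc⟩ := h
  cases t with
  | zero => exact absurd (h0.symm.trans h1) bot_ne_top
  | succ n =>
    obtain ⟨e⟩ := hc (Fin.last n)
    have htop : c (Fin.last n).succ = ⊤ := h1
    refine ⟨e.toLinearMap ∘ₗ Submodule.mkQ _ ∘ₗ (LinearEquiv.ofTop _ htop).symm.toLinearMap, ?_⟩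
    exact e.surjective.comp ((Submodule.mkQ_surjective _).comp (LinearEquiv.surjective _))

theorem InFilt.refl (X : FDModule Λ) : InFilt X X.carrier := by
  refine ⟨1, ![⊥, ⊤], ?_, rfl, rfl, ?_⟩
  · rw [Fin.monotone_iff_le_succ]
    intro i
    fin_cases i
    exact bot_le
  · intro k
    fin_cases k
    exact ⟨(Submodule.quotEquivOfEqBot _ (LinearMap.ker_eq_bot.2 (Submodule.injective_subtype _))).trans
      Submodule.topEquiv⟩

/-- If a brick `A` surjects onto a nonzero module filtered by `A`, then the two are isomorphic. -/
theorem IsBrick.nonempty_equiv_of_surjective {A C : FDModule Λ} (hA : IsBrick A)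
    [Nontrivial C.carrier] (hC : InFilt A C.carrier) (f : A.carrier →ₗ[Λ] C.carrier)
    (hf : Function.Surjective f) : Nonempty (A.carrier ≃ₗ[Λ] C.carrier) := by
  obtain ⟨g, hg⟩ := hC.exists_surjective
  have := hA.1
  have hgf : Function.Surjective (g ∘ₗ f) := hg.comp hf
  rcases hA.2 (g ∘ₗ f) with h0 | hbij
  · rw [h0] at hgf
    obtain ⟨a, ha⟩ := exists_ne (0 : A.carrier)
    obtain ⟨b, hb⟩ := hgf a
    exact absurd hb.symm ha
  · exact ⟨LinearEquiv.ofBijective f ⟨Function.Injective.of_comp (f := g) hbij.1, hf⟩⟩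

/-- Every module has a submodule in the torsion class `U` with quotient in `U^⊥`. -/
theorem IsTorsionClass.exists_torsion_submodule [IsNoetherianRing Λ] {U : Set (FDModule Λ)}
    (hU : IsTorsionClass U) (X : FDModule Λ) :
    ∃ N : Submodule Λ X.carrier, FDModule.mk N ∈ U ∧ FDModule.mk (X.carrier ⧸ N) ∈ PerpSet U := by
  obtain ⟨-, hzero, hquot, hext⟩ := hU
  let S : Set (Submodule Λ X.carrier) := {N | FDModule.mk N ∈ U}
  have hS : S.Nonempty := ⟨⊥, hzero _ (inferInstanceAs (Subsingleton (⊥ : Submodule Λ X.carrier)))⟩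
  obtain ⟨N, hN, hmax⟩ := WellFounded.has_min (r := (· > ·)) wellFounded_gt S hS
  refine ⟨N, hN, fun Y hY f => ?_⟩
  let P : Submodule Λ X.carrier := (LinearMap.range f).comap N.mkQ
  have hNP : N ≤ P := by
    intro x hx
    have hx0 : N.mkQ x = 0 := (Submodule.Quotient.mk_eq_zero N).2 hx
    exact Submodule.mem_comap.2 (hx0 ▸ Submodule.zero_mem _)
  have hR : FDModule.mk (LinearMap.range f) ∈ U :=
    hquot Y _ hY ⟨f.rangeRestrict, f.surjective_rangeRestrict⟩
  have hP : P ∈ S := by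
    refine hext (FDModule.mk N) (FDModule.mk P) (FDModule.mk (LinearMap.range f)) hN hR
      (Submodule.inclusion hNP) (N.mkQ.restrict (p := P) (q := LinearMap.range f) fun x hx => hx)
      ⟨Submodule.inclusion_injective hNP, ?_, ?_⟩
    · ext ⟨x, hx⟩
      rw [Submodule.range_inclusion, LinearMap.mem_ker, Submodule.mem_comap, Subtype.ext_iff]
      exact (Submodule.Quotient.mk_eq_zero N).symm
    · rintro ⟨y, hy⟩
      obtain ⟨x, rfl⟩ := N.mkQ_surjective y
      exact ⟨⟨x, hy⟩, rfl⟩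
  have hPN : P = N := (hNP.lt_or_eq.resolve_left (hmax P hP)).symm
  ext y
  obtain ⟨x, hx⟩ := N.mkQ_surjective (f y)
  have hxP : x ∈ P := Submodule.mem_comap.2 (hx ▸ LinearMap.mem_range_self f y)
  rw [LinearMap.zero_apply, ← hx]
  exact (Submodule.Quotient.mk_eq_zero N).2 (hPN ▸ hxP)

theorem IsBrickLabel.mem {T U : Set (FDModule Λ)} {B : FDModule Λ} (h : IsBrickLabel T U B) :
    B ∈ T ∩ PerpSet U :=
  h.2 ▸ InFilt.refl B

theorem IsBrickLabel.notMem {T U : Set (FDModule Λ)} {B : FDModule Λ}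
    (h : IsBrickLabel T U B) : B ∉ U := by
  intro hB
  have := h.1.1
  obtain ⟨b, hb⟩ := exists_ne (0 : B.carrier)
  exact hb (LinearMap.congr_fun (h.mem.2 B hB LinearMap.id) b)

theorem PerpSet.anti {U V : Set (FDModule Λ)} (h : U ⊆ V) : PerpSet V ⊆ PerpSet U :=
  fun _ hM Y hY => hM Y (h hY)

/-- A module in `T` but not in `U` surjects onto the label of `T ⊃ U`. -/
theorem IsBrickLabel.exists_surjective [IsNoetherianRing Λ] {T U : Set (FDModule Λ)}
    {B X : FDModule Λ} (h : IsBrickLabel T U B) (hT : IsTorsionClass T) (hU : IsTorsionClass U)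
    (hXT : X ∈ T) (hXU : X ∉ U) : ∃ f : X.carrier →ₗ[Λ] B.carrier, Function.Surjective f := by
  obtain ⟨N, hN, hperp⟩ := hU.exists_torsion_submodule X
  have hNtop : N ≠ ⊤ := by
    rintro rfl
    exact hXU (hU.1 _ _ hN ⟨Submodule.topEquiv⟩)
  have : Nontrivial (X.carrier ⧸ N) := Submodule.Quotient.nontrivial_iff.2 hNtop
  have hquot : FDModule.mk (X.carrier ⧸ N) ∈ T ∩ PerpSet U :=
    ⟨hT.2.2.1 X _ hXT ⟨N.mkQ, N.mkQ_surjective⟩, hperp⟩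
  rw [h.2] at hquot
  obtain ⟨g, hg⟩ := InFilt.exists_surjective hquot
  exact ⟨g ∘ₗ N.mkQ, hg.comp N.mkQ_surjective⟩

theorem IsTorsionClass.inter {T U : Set (FDModule Λ)} (hT : IsTorsionClass T)
    (hU : IsTorsionClass U) : IsTorsionClass (T ∩ U) :=
  ⟨fun M N hM e => ⟨hT.1 M N hM.1 e, hU.1 M N hM.2 e⟩,
    fun M h => ⟨hT.2.1 M h, hU.2.1 M h⟩,
    fun M N hM hf => ⟨hT.2.2.1 M N hM.1 hf, hU.2.2.1 M N hM.2 hf⟩,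
    fun L M N hL hN f g h =>
      ⟨hT.2.2.2 L M N hL.1 hN.1 f g h, hU.2.2.2 L M N hL.2 hN.2 f g h⟩⟩

/-- If `T ⊃ U` and `T' ⊃ U'` are labelled by `A` and `C`, where `T' ⊆ T`, `U' ⊆ U` and
`T' ∩ U ⊆ U'`, then the labels are isomorphic. -/
theorem IsBrickLabel.nonempty_equiv [IsNoetherianRing Λ] {T U T' U' : Set (FDModule Λ)}
    {A C : FDModule Λ} (hC : IsBrickLabel T U C) (hA : IsBrickLabel T' U' A)
    (hT : IsTorsionClass T) (hU : IsTorsionClass U) (hT' : IsTorsionClass T')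
    (hTT : T' ⊆ T) (hUU : U' ⊆ U) (hinter : T' ∩ U ⊆ U') :
    Nonempty (A.carrier ≃ₗ[Λ] C.carrier) := by
  obtain ⟨f, hf⟩ := hC.exists_surjective hT hU (hTT hA.mem.1)
    fun h => hA.notMem (hinter ⟨hA.mem.1, h⟩)
  have hmem : C ∈ T' ∩ PerpSet U' :=
    ⟨hT'.2.2.1 A C hA.mem.1 ⟨f, hf⟩, PerpSet.anti hUU hC.mem.2⟩
  rw [hA.2] at hmem
  have := hC.1.1
  exact hA.1.nonempty_equiv_of_surjective hmem f hf

end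

/-- if `T ⊃ V ⊃ U` is a chain of minimal inclusions of torsion
classes labelled by bricks `L` and `M`, and `T = W 0 ⊃ W 1 ⊃ … ⊃ W r = U` (with
`r ≥ 2` and `W 1 ≠ V`) is another chain of minimal inclusions labelled by bricks
`B 0, …, B (r-1)`, then the first label is isomorphic to `M` and the last label
is isomorphic to `L`. -/
theorem statement_15 (K : Type) [Field K] (Λ : Type) [Ring Λ] [Algebra K Λ]
    [FiniteDimensional K Λ]
    (T V U : Set (FDModule Λ)) (L M : FDModule Λ)
    (h1 : IsMinimalInclusion T V) (h2 : IsMinimalInclusion V U)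
    (lL : IsBrickLabel T V L) (lM : IsBrickLabel V U M)
    {r : ℕ} (hr : 2 ≤ r)
    (W : Fin (r + 1) → Set (FDModule Λ)) (B : Fin r → FDModule Λ)
    (hW0 : W 0 = T) (hWr : W (Fin.last r) = U) (hW1 : W 1 ≠ V)
    (hchain : ∀ k : Fin r, IsMinimalInclusion (W k.castSucc) (W k.succ))
    (hlabel : ∀ k : Fin r, IsBrickLabel (W k.castSucc) (W k.succ) (B k)) :
    Nonempty ((B ⟨0, by omega⟩).carrier ≃ₗ[Λ] M.carrier) ∧
      Nonempty ((B ⟨r - 1, by omega⟩).carrier ≃ₗ[Λ] L.carrier) := by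
  have : IsNoetherianRing Λ := isNoetherian_of_tower K inferInstance
  obtain ⟨n, rfl⟩ := Nat.exists_eq_add_of_le' hr
  have hanti : Antitone W := Fin.antitone_iff_succ_le.2 fun k => (hchain k).2.2.1.subset
  have hfirst := hchain 0
  have hlast := hchain (Fin.last (n + 1))
  have lfirst := hlabel 0
  have llast := hlabel (Fin.last (n + 1))
  rw [Fin.succ_last, hWr] at hlast llast
  rw [Fin.castSucc_zero, hW0] at hfirst lfirst
  change IsMinimalInclusion T (W 1) at hfirst
  change IsBrickLabel T (W 1) _ at lfirst
  set X := W (Fin.last (n + 1)).castSucc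
  have hXW : X ⊆ W 1 := hanti (by simp [Fin.le_def])
  have hXT : X ⊆ T := hXW.trans hfirst.2.2.1.subset
  have hUW : U ⊆ W 1 := hlast.2.2.1.subset.trans hXW
  have hinter : V ∩ W 1 = U := by
    refine (h2.2.2.2 _ (h2.1.inter hfirst.2.1) (Set.subset_inter h2.2.2.1.subset hUW)
      Set.inter_subset_left).resolve_right fun h => ?_
    rcases h1.2.2.2 _ hfirst.2.1 (Set.inter_eq_left.1 h) hfirst.2.2.1.subset with h | h
    · exact hW1 h
    · exact hfirst.2.2.1.ne h
  constructor
  · exact (lfirst.nonempty_equiv lM h1.1 hfirst.2.1 h2.1 h1.2.2.1.subset hUW hinter.subset).map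
      LinearEquiv.symm
  · exact lL.nonempty_equiv llast h1.1 h1.2.1 hlast.1 hXT h2.2.2.1.subset
      fun Y hY => hinter.subset ⟨hY.2, hXW hY.1⟩
end

section
/- Let G = (B_1, …, B_r) be a maximal backwards Hom-orthogonal sequence of bricks over Λ, and let 1 ≤ i ≤ r − 1 be such that Hom_Λ(B_i, B_{i+1}) = 0, Hom_Λ(B_{i+1}, B_i) = 0, every short exact sequence 0 → B_i → X → B_{i+1} → 0 splits, and every short exact sequence 0 → B_{i+1} → X → B_i → 0 splits. Let G' be the sequence obtained from G by swapping B_i and B_{i+1}. If a non-zero module M admits a G-Harder–Narasimhan filtration with factors F_1, …, F_l, then M admits a G'-Harder–Narasimhan filtration whose multiset of factors, up to isomorphism, is again {F_1, …, F_l}. -/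
/-- The sequence of modules `B 0, …, B (r-1)` is backwards Hom-orthogonal:
`Hom(B j, B i) = 0` whenever `i < j`. -/
def BackwardsHomOrthogonal {Λ : Type} [Ring Λ] {r : ℕ} (B : Fin r → FDModule Λ) : Prop :=
  ∀ i j : Fin r, i < j → NoHom (B j) (B i)

/-- `B` is a maximal backwards Hom-orthogonal sequence of bricks: each entry is a
brick, the sequence is backwards Hom-orthogonal, and for every brick `C` and every
position `0 ≤ k ≤ r`, inserting `C` after the first `k` entries destroys backwards
Hom-orthogonality. -/
def IsMaximalBHO {Λ : Type} [Ring Λ] {r : ℕ} (B : Fin r → FDModule Λ) : Prop :=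
  (∀ i, IsBrick (B i)) ∧ BackwardsHomOrthogonal B ∧
    ∀ C : FDModule Λ, IsBrick C → ∀ k : ℕ, k ≤ r →
      ¬ ((∀ i : Fin r, (i : ℕ) < k → NoHom C (B i)) ∧
         (∀ j : Fin r, k ≤ (j : ℕ) → NoHom (B j) C))

/-- `d`, together with the strictly increasing choice of indices `j`, is a
Harder–Narasimhan filtration of `M` with respect to the sequence of bricks `C`:
`M = d 0 ⊃ d 1 ⊃ … ⊃ d l = 0` and the `k`-th factor `d k / d (k+1)` lies in
`Filt(C (j k))` with `j` strictly monotone. -/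
def IsHNFiltration {Λ : Type} [Ring Λ] {r : ℕ} (C : Fin r → FDModule Λ)
    (M : FDModule Λ) {l : ℕ} (d : Fin (l + 1) → Submodule Λ M.carrier)
    (j : Fin l → Fin r) : Prop :=
  StrictAnti d ∧ d 0 = ⊤ ∧ d (Fin.last l) = ⊥ ∧ StrictMono j ∧
    ∀ k : Fin l,
      InFilt (C (j k))
        (↥(d k.castSucc) ⧸ Submodule.comap (d k.castSucc).subtype (d k.succ))

namespace Submodule

variable {R M N : Type*} [Ring R] [AddCommGroup M] [Module R M] [AddCommGroup N] [Module R N]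

/-- A linear map inducing a bijection between two subquotients gives an isomorphism. -/
theorem nonempty_subquotient_equiv (f : M →ₗ[R] N) {a b : Submodule R M} {a' b' : Submodule R N}
    (hb : b ≤ b'.comap f) (hs : b' ≤ b.map f ⊔ a') (hk : b ⊓ a'.comap f = b ⊓ a) :
    Nonempty ((↥b ⧸ comap b.subtype a) ≃ₗ[R] (↥b' ⧸ comap b'.subtype a')) := by
  let φ : ↥b →ₗ[R] (↥b' ⧸ comap b'.subtype a') :=
    (comap b'.subtype a').mkQ ∘ₗ (f ∘ₗ b.subtype).codRestrict b' fun x => hb x.2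
  have hφ (x : b) : φ x = 0 ↔ f x ∈ a' := by
    simp [φ, Submodule.Quotient.mk_eq_zero]
  have hker : comap b.subtype a = LinearMap.ker φ := by
    ext x
    have := SetLike.ext_iff.1 hk (x : M)
    simp only [mem_inf, x.2, true_and, mem_comap] at this
    simp only [LinearMap.mem_ker, hφ, mem_comap, subtype_apply, this]
  have hsurj : Function.Surjective φ := by
    intro y
    obtain ⟨⟨y, hy⟩, rfl⟩ := mkQ_surjective _ y
    obtain ⟨_, ⟨x, hx, rfl⟩, z, hz, hxz⟩ := mem_sup.1 (hs hy)
    refine ⟨⟨x, hx⟩, ?_⟩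
    simp only [φ, LinearMap.comp_apply, mkQ_apply]
    rw [Submodule.Quotient.eq]
    have : f x - y = -z := by rw [← hxz]; abel
    simpa [this] using hz
  exact ⟨(quotEquivOfEq _ _ hker).trans (φ.quotKerEquivOfSurjective hsurj)⟩

/-- The second isomorphism theorem for subquotients. -/
theorem nonempty_inf_equiv_sup (a b : Submodule R M) :
    Nonempty ((↥a ⧸ comap a.subtype (a ⊓ b)) ≃ₗ[R] (↥(a ⊔ b) ⧸ comap (a ⊔ b).subtype b)) :=
  nonempty_subquotient_equiv LinearMap.id (by simp) (by simp) (by simp)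

end Submodule

section ModularLattice

open Relation

variable {α : Type*} [Lattice α] [IsModularLattice α] {P Q : α → α → Prop}

/-- A transposition-invariant relation on intervals has a transposition-invariant
reflexive transitive closure. -/
theorem reflTransGen_sup_of_inf (hle : ∀ a b, Q a b → a ≤ b)
    (hQ : ∀ a b, Q (a ⊓ b) a → Q b (a ⊔ b)) {a b : α} (h : ReflTransGen Q (a ⊓ b) a) :
    ReflTransGen Q b (a ⊔ b) := by
  have hle' : ∀ x y, ReflTransGen Q x y → x ≤ y := fun x y hxy => by
    induction hxy with
    | refl => rfl
    | tail _ h ih => exact ih.trans (hle _ _ h)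
  suffices ∀ x, ReflTransGen Q (a ⊓ b) x → x ≤ a → ReflTransGen Q b (x ⊔ b) from
    this a h le_rfl
  intro x hx
  induction hx with
  | refl => intro _; rw [sup_eq_right.2 inf_le_right]
  | @tail x y hx hxy ih =>
    intro hya
    have hx' := hle _ _ hxy
    refine (ih (hx'.trans hya)).tail ?_
    have key : y ⊓ (x ⊔ b) = x := by
      rw [inf_comm, sup_inf_assoc_of_le b hx', sup_eq_left, inf_comm]
      exact (inf_le_inf_right b hya).trans (hle' _ _ hx)
    have := hQ y (x ⊔ b) (by rwa [key])
    rwa [← sup_assoc, sup_eq_left.2 hx'] at this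

/-- If consecutive intervals of types `Q` and `P` split, then so do consecutive intervals
filtered by intervals of these types. -/
theorem exists_inf_eq_sup_eq_of_reflTransGen (hle : ∀ a b, Q a b → a ≤ b)
    (hQ : ∀ a b, Q (a ⊓ b) a → Q b (a ⊔ b)) (hleP : ∀ a b, P a b → a ≤ b)
    (hP : ∀ a b, P b (a ⊔ b) → P (a ⊓ b) a)
    (hsplit : ∀ w v u, Q w v → P v u → ∃ v', v' ⊓ v = w ∧ v' ⊔ v = u)
    {w v u : α} (hwv : ReflTransGen Q w v) (hvu : ReflTransGen P v u) :
    ∃ v', v' ⊓ v = w ∧ v' ⊔ v = u := by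
  have step : ∀ w v u, ReflTransGen Q w v → P v u → ∃ v', v' ⊓ v = w ∧ v' ⊔ v = u := by
    intro w v u hwv
    induction hwv generalizing u with
    | refl => intro h; exact ⟨u, inf_eq_right.2 (hleP _ _ h), sup_eq_left.2 (hleP _ _ h)⟩
    | @tail x v _ hxv ih =>
      intro hvu
      obtain ⟨v₁, rfl, rfl⟩ := hsplit _ _ _ hxv hvu
      obtain ⟨v', h, h'⟩ := ih _ (hP _ _ hvu)
      have hle₁ : v' ≤ v₁ := h' ▸ le_sup_left
      refine ⟨v', ?_, ?_⟩
      · rw [← h, ← inf_assoc, inf_eq_left.2 hle₁]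
      · exact le_antisymm (sup_le_sup_right hle₁ _)
          (sup_le (h'.ge.trans (sup_le_sup_left inf_le_right _)) le_sup_right)
  induction hvu with
  | refl =>
    refine ⟨w, inf_eq_left.2 ?_, sup_eq_right.2 ?_⟩ <;>
    · induction hwv with
      | refl => rfl
      | tail _ h ih => exact ih.trans (hle _ _ h)
  | @tail x u _ hxu ih =>
    obtain ⟨v', rfl, rfl⟩ := ih
    rw [inf_comm] at hwv
    obtain ⟨v'', h, rfl⟩ := step _ _ _ (reflTransGen_sup_of_inf hle hQ hwv)
      (by rwa [sup_comm])
    have hle₁ : v' ≤ v'' := h ▸ inf_le_left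
    refine ⟨v'', ?_, ?_⟩
    · rw [← h, inf_assoc, inf_eq_right.2 (le_sup_left : v ≤ v ⊔ v')]
    · rw [sup_comm v v', ← sup_assoc, sup_eq_left.2 hle₁]

end ModularLattice

section Filt

open Relation

variable {Λ : Type} [Ring Λ] {M N : Type} [AddCommGroup M] [Module Λ M]
  [AddCommGroup N] [Module Λ N]

theorem InFilt.of_linearEquiv {X : FDModule Λ} (h : InFilt X M) (e : M ≃ₗ[Λ] N) :
    InFilt X N := by
  obtain ⟨t, c, hc, h0, h1, hq⟩ := h
  refine ⟨t, fun k => (c k).map e.toLinearMap, fun a b hab => Submodule.map_mono (hc hab),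
    by simp [h0], by simp [h1], fun k => ?_⟩
  obtain ⟨φ⟩ := Submodule.nonempty_subquotient_equiv e.toLinearMap
    (a := c k.castSucc) (b := c k.succ) (a' := (c k.castSucc).map e.toLinearMap)
    (b' := (c k.succ).map e.toLinearMap) (Submodule.le_comap_map _ _) le_sup_left
    (by rw [Submodule.comap_map_eq_of_injective e.injective])
  exact ⟨φ.symm.trans (hq k).some⟩

/-- `a ≤ b` and the subquotient `b / a` is isomorphic to `X`. -/
def IsSubquotientOf (X : FDModule Λ) (a b : Submodule Λ M) : Prop :=
  a ≤ b ∧ Nonempty ((↥b ⧸ Submodule.comap b.subtype a) ≃ₗ[Λ] X.carrier)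

theorem isSubquotientOf_inf_iff (X : FDModule Λ) (a b : Submodule Λ M) :
    IsSubquotientOf X (a ⊓ b) a ↔ IsSubquotientOf X b (a ⊔ b) := by
  obtain ⟨e⟩ := Submodule.nonempty_inf_equiv_sup a b
  exact ⟨fun h => ⟨le_sup_right, ⟨e.symm.trans h.2.some⟩⟩,
    fun h => ⟨inf_le_left, ⟨e.trans h.2.some⟩⟩⟩

theorem InFilt.reflTransGen {X : FDModule Λ} {a b : Submodule Λ M} (hab : a ≤ b)
    (h : InFilt X (↥b ⧸ Submodule.comap b.subtype a)) :
    ReflTransGen (IsSubquotientOf X) a b := by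
  obtain ⟨t, c, hc, h0, h1, hq⟩ := h
  let π := (Submodule.comap b.subtype a).mkQ
  let D : Fin (t + 1) → Submodule Λ M := fun k => ((c k).comap π).map b.subtype
  have hD0 : D 0 = a := by
    simp only [D, h0, π]
    rw [Submodule.comap_bot, Submodule.ker_mkQ, Submodule.map_comap_subtype, inf_eq_right.2 hab]
  have hD1 : D (Fin.last t) = b := by simp [D, h1]
  suffices ∀ k, ReflTransGen (IsSubquotientOf X) (D 0) (D k) by
    simpa only [hD0, hD1] using this (Fin.last t)
  intro k
  induction k using Fin.induction with
  | zero => exact .refl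
  | succ k ih =>
    refine ih.tail ⟨Submodule.map_mono (Submodule.comap_mono (hc (Fin.castSucc_le_succ k))), ?_⟩
    obtain ⟨e₁⟩ := Submodule.nonempty_subquotient_equiv π
      (a := (c k.castSucc).comap π) (b := (c k.succ).comap π) (a' := c k.castSucc)
      (b' := c k.succ) le_rfl
      (by rw [Submodule.map_comap_eq_of_surjective (Submodule.mkQ_surjective _)]
          exact le_sup_left) rfl
    obtain ⟨e₂⟩ := Submodule.nonempty_subquotient_equiv b.subtype
      (a := (c k.castSucc).comap π) (b := (c k.succ).comap π) (a' := D k.castSucc)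
      (b' := D k.succ) (Submodule.le_comap_map _ _) le_sup_left
      (by rw [Submodule.comap_map_eq_of_injective b.injective_subtype])
    exact ⟨e₂.symm.trans (e₁.trans (hq k).some)⟩

/-- If every extension of `X` by `Y` splits, then the extension of `u / v ≅ X` by
`v / w ≅ Y` afforded by `w ≤ v ≤ u` splits. -/
theorem IsSubquotientOf.exists_inf_eq_sup_eq [IsNoetherian Λ M] {X Y : FDModule Λ}
    (hsplit : ∀ (E : FDModule Λ) (f : Y.carrier →ₗ[Λ] E.carrier)
      (g : E.carrier →ₗ[Λ] X.carrier), IsShortExact f g → SESSplits g)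
    {w v u : Submodule Λ M} (hwv : IsSubquotientOf Y w v) (hvu : IsSubquotientOf X v u) :
    ∃ v', v' ⊓ v = w ∧ v' ⊔ v = u := by
  obtain ⟨hwv, ⟨e⟩⟩ := hwv
  obtain ⟨hvu, ⟨e'⟩⟩ := hvu
  let f₀ : (↥v ⧸ Submodule.comap v.subtype w) →ₗ[Λ] (↥u ⧸ Submodule.comap u.subtype w) :=
    Submodule.mapQ _ _ (Submodule.inclusion hvu) fun x hx => hx
  let g₀ : (↥u ⧸ Submodule.comap u.subtype w) →ₗ[Λ] (↥u ⧸ Submodule.comap u.subtype v) :=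
    Submodule.mapQ _ _ LinearMap.id fun x hx => hwv hx
  have hf₀_mk (x : v) :
      f₀ (Submodule.Quotient.mk x) = Submodule.Quotient.mk (Submodule.inclusion hvu x) := rfl
  have hg₀ (x : u) : g₀ (Submodule.Quotient.mk x) = Submodule.Quotient.mk x := rfl
  have hf₀ : Function.Injective f₀ := by
    rw [injective_iff_map_eq_zero]
    intro x hx
    obtain ⟨x, rfl⟩ := Submodule.Quotient.mk_surjective _ x
    rw [hf₀_mk, Submodule.Quotient.mk_eq_zero] at hx
    rw [Submodule.Quotient.mk_eq_zero]
    exact hx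
  have hg₀s : Function.Surjective g₀ := fun y => by
    obtain ⟨y, rfl⟩ := Submodule.Quotient.mk_surjective _ y
    exact ⟨Submodule.Quotient.mk y, rfl⟩
  have hex : LinearMap.range f₀ = LinearMap.ker g₀ := by
    ext x
    obtain ⟨x, rfl⟩ := Submodule.Quotient.mk_surjective _ x
    rw [LinearMap.mem_ker, hg₀, Submodule.Quotient.mk_eq_zero]
    constructor
    · rintro ⟨y, hy⟩
      obtain ⟨y, rfl⟩ := Submodule.Quotient.mk_surjective _ y
      rw [hf₀_mk, Submodule.Quotient.eq] at hy
      have hy' : (y : M) - x ∈ w := hy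
      have := v.sub_mem y.2 (hwv hy')
      simpa using this
    · intro hx
      exact ⟨Submodule.Quotient.mk ⟨x, hx⟩, rfl⟩
  obtain ⟨s, hs⟩ := hsplit ⟨↥u ⧸ Submodule.comap u.subtype w⟩ (f₀ ∘ₗ e.symm.toLinearMap)
    (e'.toLinearMap ∘ₗ g₀)
    ⟨hf₀.comp e.symm.injective,
      by rw [LinearMap.range_comp_of_range_eq_top _ (LinearEquiv.range _), hex,
        LinearMap.ker_comp_of_ker_eq_bot _ (LinearEquiv.ker _)],
      e'.surjective.comp hg₀s⟩
  have hs' (y : X.carrier) : e' (g₀ (s y)) = y := LinearMap.congr_fun hs y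
  have hmem (x : u) : g₀ (Submodule.Quotient.mk x) = 0 ↔ (x : M) ∈ v := by
    rw [hg₀, Submodule.Quotient.mk_eq_zero]; rfl
  let v' := ((LinearMap.range s).comap (Submodule.comap u.subtype w).mkQ).map u.subtype
  refine ⟨v', le_antisymm ?_ (le_inf ?_ hwv), le_antisymm (sup_le ?_ hvu) ?_⟩
  · rintro _ ⟨⟨x, ⟨y, hy⟩, rfl⟩, hx⟩
    have h0 : y = 0 := by
      rw [← hs' y, hy, Submodule.mkQ_apply, (hmem x).2 hx, map_zero]
    rw [h0, map_zero, eq_comm, Submodule.mkQ_apply, Submodule.Quotient.mk_eq_zero] at hy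
    exact hy
  · intro x hx
    refine ⟨⟨x, hvu (hwv hx)⟩, ⟨0, ?_⟩, rfl⟩
    rw [map_zero, eq_comm, Submodule.mkQ_apply, Submodule.Quotient.mk_eq_zero]
    exact hx
  · exact Submodule.map_subtype_le _ _
  · intro x hx
    obtain ⟨z, hz⟩ := Submodule.Quotient.mk_surjective _
      (s (e' (g₀ (Submodule.Quotient.mk ⟨x, hx⟩))))
    refine Submodule.mem_sup.2 ⟨z, ⟨z, ⟨_, hz.symm⟩, rfl⟩, x - z, ?_, by abel⟩
    refine (hmem (⟨x, hx⟩ - z)).1 ?_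
    rw [Submodule.Quotient.mk_sub, map_sub, hz, sub_eq_zero]
    exact e'.injective (hs' _).symm

/-- If every extension of `X` by `Y` splits, then so does every extension of a module in
`Filt(X)` by a module in `Filt(Y)`. -/
theorem InFilt.exists_inf_eq_sup_eq [IsNoetherian Λ M] {X Y : FDModule Λ}
    (hsplit : ∀ (E : FDModule Λ) (f : Y.carrier →ₗ[Λ] E.carrier)
      (g : E.carrier →ₗ[Λ] X.carrier), IsShortExact f g → SESSplits g)
    {w v u : Submodule Λ M} (hwv : w ≤ v) (hvu : v ≤ u)
    (hY : InFilt Y (↥v ⧸ Submodule.comap v.subtype w))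
    (hX : InFilt X (↥u ⧸ Submodule.comap u.subtype v)) :
    ∃ v', v' ⊓ v = w ∧ v' ⊔ v = u :=
  exists_inf_eq_sup_eq_of_reflTransGen (fun _ _ h => h.1)
    (fun a b => (isSubquotientOf_inf_iff Y a b).1) (fun _ _ h => h.1)
    (fun a b => (isSubquotientOf_inf_iff X a b).2)
    (fun _ _ _ h h' => h.exists_inf_eq_sup_eq hsplit h')
    (hY.reflTransGen hwv) (hX.reflTransGen hvu)

end Filt

/-- A strictly increasing sequence missing one of two consecutive values stays strictly
increasing when these values are swapped. -/
theorem StrictMono.swap_comp {l r : ℕ} {j : Fin l → Fin r} (hj : StrictMono j) {p q : Fin r}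
    (hpq : (q : ℕ) = p + 1) (h : ¬((∃ k, j k = p) ∧ ∃ k, j k = q)) :
    StrictMono fun k => Equiv.swap p q (j k) := by
  intro a b hab
  have hlt := hj hab
  have hap : ∀ c d, j c = p → j d ≠ q := fun c d hc hd => h ⟨⟨c, hc⟩, d, hd⟩
  have h1 := hap a b
  have h2 := hap b a
  simp only [Equiv.swap_apply_def]
  simp only [ne_eq, Fin.lt_def, Fin.ext_iff] at *
  split_ifs <;> omega

/-- swapping two adjacent entries `B i`, `B (i+1)` of a maximal
backwards Hom-orthogonal sequence of bricks which are Hom-orthogonal in both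
directions and have no non-split extensions in either direction preserves
Harder–Narasimhan filtrations: any module admitting a `G`-HN filtration admits a
`G'`-HN filtration with the same multiset of factors up to isomorphism. -/
theorem statement_16 (K : Type) [Field K] (Λ : Type) [Ring Λ] [Algebra K Λ]
    [FiniteDimensional K Λ]
    {r : ℕ} (B : Fin r → FDModule Λ) (hmax : IsMaximalBHO B)
    (i : Fin r) (hi : (i : ℕ) + 1 < r)
    (h1 : NoHom (B i) (B ⟨(i : ℕ) + 1, hi⟩))
    (h2 : NoHom (B ⟨(i : ℕ) + 1, hi⟩) (B i))
    (h3 : ∀ (X : FDModule Λ) (f : (B i).carrier →ₗ[Λ] X.carrier)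
        (g : X.carrier →ₗ[Λ] (B ⟨(i : ℕ) + 1, hi⟩).carrier),
        IsShortExact f g → SESSplits g)
    (h4 : ∀ (X : FDModule Λ) (f : (B ⟨(i : ℕ) + 1, hi⟩).carrier →ₗ[Λ] X.carrier)
        (g : X.carrier →ₗ[Λ] (B i).carrier),
        IsShortExact f g → SESSplits g)
    (M : FDModule Λ) (hM : Nontrivial M.carrier)
    {l : ℕ} (d : Fin (l + 1) → Submodule Λ M.carrier) (j : Fin l → Fin r)
    (hd : IsHNFiltration B M d j) :
    ∃ (d' : Fin (l + 1) → Submodule Λ M.carrier) (j' : Fin l → Fin r),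
      IsHNFiltration (fun k => B (Equiv.swap i ⟨(i : ℕ) + 1, hi⟩ k)) M d' j' ∧
      ∃ σ : Equiv.Perm (Fin l), ∀ k : Fin l,
        Nonempty
          ((↥(d' k.castSucc) ⧸ Submodule.comap (d' k.castSucc).subtype (d' k.succ))
            ≃ₗ[Λ]
          (↥(d (σ k).castSucc) ⧸
            Submodule.comap (d (σ k).castSucc).subtype (d (σ k).succ))) := by
  set q : Fin r := ⟨(i : ℕ) + 1, hi⟩ with hq
  have hpq : (q : ℕ) = i + 1 := rfl
  obtain ⟨hanti, htop, hbot, hmono, hfilt⟩ := hd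
  by_cases h : (∃ k, j k = i) ∧ ∃ k, j k = q
  swap
  · refine ⟨d, fun k => Equiv.swap i q (j k),
      ⟨hanti, htop, hbot, hmono.swap_comp hpq h, fun k => ?_⟩, 1, fun k => ⟨.refl _ _⟩⟩
    simpa using hfilt k
  obtain ⟨⟨k, hk⟩, k', hk'⟩ := h
  have hkk' : k < k' := hmono.lt_iff_lt.1 (by rw [hk, hk', Fin.lt_def]; omega)
  have hsucc : (k' : ℕ) = k + 1 := by
    by_contra hne
    have hlt : (k : ℕ) + 1 < k' := by rw [Fin.lt_def] at hkk'; omega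
    have ha : k < ⟨k + 1, hlt.trans k'.2⟩ := by rw [Fin.lt_def]; simp
    have hb : (⟨k + 1, hlt.trans k'.2⟩ : Fin l) < k' := hlt
    have ha' := hmono ha
    have hb' := hmono hb
    rw [Fin.lt_def] at ha' hb'
    rw [hk] at ha'
    rw [hk'] at hb'
    omega
  have hks : k.succ = k'.castSucc := Fin.ext (by simp [hsucc])
  have : IsNoetherianRing Λ := IsNoetherianRing.of_finite K Λ
  have hwv := hanti k'.castSucc_lt_succ
  have hvu := hanti k.castSucc_lt_succ
  have hfk := hfilt k
  rw [hk] at hfk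
  have hfk' := hfilt k'
  rw [hk'] at hfk'
  rw [hks] at hvu hfk
  obtain ⟨v', hinf, hsup⟩ := hfk'.exists_inf_eq_sup_eq h4 hwv.le hvu.le hfk
  set w := d k'.succ with hw
  set v := d k'.castSucc with hv
  set u := d k.castSucc with hu
  have hwv' : w < v' := by
    refine lt_of_le_of_ne (hinf ▸ inf_le_left) fun he => hvu.ne ?_
    rw [← hsup, ← he, sup_eq_right.2 hwv.le]
  have hvu' : v' < u := by
    refine lt_of_le_of_ne (hsup ▸ le_sup_left) fun he => hwv.ne ?_
    rw [← hinf, he, inf_eq_right.2 hvu.le]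
  let d' := Function.update d k'.castSucc v'
  have hd' : ∀ m, m ≠ k'.castSucc → d' m = d m := fun m hm => Function.update_of_ne hm _ _
  have hd'v : d' k'.castSucc = v' := Function.update_self _ _ _
  have hcases : ∀ m : Fin l, m = k ∨ m = k' ∨
      (m ≠ k ∧ m ≠ k' ∧ m.castSucc ≠ k'.castSucc ∧ m.succ ≠ k'.castSucc) := by
    intro m
    simp only [ne_eq, Fin.ext_iff, Fin.val_castSucc, Fin.val_succ]
    omega
  have hkc : d' k.castSucc = u := hd' _ (by simp [hkk'.ne])
  have hkc' : d' k'.succ = w := hd' _ (by simp [Fin.ext_iff])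
  have hequiv : ∀ m : Fin l, Nonempty
      ((↥(d' m.castSucc) ⧸ Submodule.comap (d' m.castSucc).subtype (d' m.succ)) ≃ₗ[Λ]
        (↥(d (Equiv.swap k k' m).castSucc) ⧸
          Submodule.comap (d (Equiv.swap k k' m).castSucc).subtype
            (d (Equiv.swap k k' m).succ))) := by
    intro m
    obtain rfl | rfl | ⟨ha, hb, hc, hc'⟩ := hcases m
    · obtain ⟨e⟩ := Submodule.nonempty_inf_equiv_sup v v'
      rw [inf_comm, hinf, sup_comm, hsup] at e
      rw [Equiv.swap_apply_left, hks, hkc, hd'v]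
      exact ⟨e.symm⟩
    · obtain ⟨e⟩ := Submodule.nonempty_inf_equiv_sup v' v
      rw [hinf, hsup] at e
      rw [Equiv.swap_apply_right, hd'v, hkc', hks]
      exact ⟨e⟩
    · rw [Equiv.swap_apply_of_ne_of_ne ha hb, hd' _ hc, hd' _ hc']
      exact ⟨.refl _ _⟩
  have hj : ∀ m, Equiv.swap i q (j m) = j (Equiv.swap k k' m) := by
    intro m
    rw [← hk, ← hk', hmono.injective.swap_apply]
  refine ⟨d', j, ⟨Fin.strictAnti_iff_succ_lt.2 fun m => ?_, ?_, ?_, hmono, fun m => ?_⟩,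
    Equiv.swap k k', hequiv⟩
  · obtain rfl | rfl | ⟨-, -, hc, hc'⟩ := hcases m
    · rwa [hks, hkc, hd'v]
    · rwa [hd'v, hkc']
    · rw [hd' _ hc, hd' _ hc']
      exact hanti m.castSucc_lt_succ
  · rw [hd' _ (by simp [Fin.ext_iff, hsucc]), htop]
  · rw [hd' _ (Fin.castSucc_lt_last k').ne', hbot]
  · simp only [hj]
    exact (hfilt _).of_linearEquiv (hequiv m).some.symm
end
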